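/- Let 0 < η ≤ 1 and let (F_k)_{k≥0} and (G_k)_{k≥0} be Schur chains with Szegő constants η(F) ≥ η and η(G) ≥ η. Define initial data q₀,F(n) = F_n(0) for n ≥ 0 and q₀,F(n) = 0 for n < 0, and similarly q₀,G(n) = G_n(0) for n ≥ 0 and 0 for n < 0. Let q_F and q_G solve the Ablowitz–Ladik equation on ℝ with initial data q₀,F and q₀,G respectively, both taking values in the open unit disc. Then for every t > 0, every r ∈ (0,1), and every j ∈ ℤ: |q_F(t,j) − q_G(t,j)| ≤ r^{−j} · e^{t/r} · C(η,r) · sup_{|z| = r} |F_0(z) − G_0(z)|. -/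

import Mathlib

open Complex Metric Finset Filter

noncomputable section

/-- A Schur chain: each `F k` is analytic on the open unit disc, bounded by `1` there,
`‖F k 0‖ < 1`, and the Schur algorithm recursion holds. -/
def IsSchurChain (F : ℕ → ℂ → ℂ) : Prop :=
  ∀ k : ℕ,
    DifferentiableOn ℂ (F k) (Metric.ball 0 1) ∧
    (∀ z ∈ Metric.ball (0 : ℂ) 1, ‖F k z‖ ≤ 1) ∧
    ‖F k 0‖ < 1 ∧
    ∀ z ∈ Metric.ball (0 : ℂ) 1,
      z * F (k + 1) z * (1 - (starRingEnd ℂ) (F k 0) * F k z) = F k z - F k 0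

/-- The Szegő constant of a Schur chain: the limit (equivalently the infimum, since the
partial products are nonincreasing and lie in `[0,1]`) of `∏_{k<N} (1 - ‖F k 0‖²)`. -/
def szego (F : ℕ → ℂ → ℂ) : ℝ :=
  ⨅ N : ℕ, ∏ k ∈ Finset.range N, (1 - ‖F k 0‖ ^ 2)

/-- The constant `C(η, r)`. -/
def Cconst (η r : ℝ) : ℝ :=
  Real.exp (Real.log (1 / η) * (2 + 1 / (1 - Real.sqrt (1 - η))) * (4 / (1 - r) ^ 2 + 1))

/-- The right-hand side of the Ablowitz–Ladik equation:
`i·(1 − |q(t,n)|²)·(q(t,n−1) + q(t,n+1))`. -/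
def ALDeriv (q : ℝ → ℤ → ℂ) (t : ℝ) (n : ℤ) : ℂ :=
  Complex.I * ((1 - ‖q t n‖ ^ 2 : ℝ) : ℂ) * (q t (n - 1) + q t (n + 1))

/-- `ℓ_n(t) = -log (1 - |q_n(t)|²)`. -/
def ell (q : ℝ → ℤ → ℂ) (n : ℤ) (t : ℝ) : ℝ := -Real.log (1 - ‖q t n‖ ^ 2)

/-- The current `J_n = 2 Im (conj q_n * q_{n+1})`. -/
def cur (q : ℝ → ℤ → ℂ) (n : ℤ) (t : ℝ) : ℝ := 2 * ((starRingEnd ℂ) (q t n) * q t (n + 1)).im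

lemma one_sub_sq_pos {z : ℂ} (h : ‖z‖ < 1) : 0 < 1 - ‖z‖ ^ 2 := by
  nlinarith [norm_nonneg z]

lemma ell_nonneg' (q : ℝ → ℤ → ℂ) (n : ℤ) (t : ℝ) (h : ‖q t n‖ < 1) : ‖q t n‖ ^ 2 ≤ ell q n t := by
  have := Real.log_le_sub_one_of_pos (one_sub_sq_pos h)
  unfold ell
  linarith

lemma ell_deriv (q : ℝ → ℤ → ℂ)
    (hq : ∀ (s : ℝ) (n : ℤ), HasDerivAt (fun u => q u n) (ALDeriv q s n) s)
    (hb : ∀ (s : ℝ) (m : ℤ), ‖q s m‖ < 1) (n : ℤ) (s : ℝ) :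
    HasDerivAt (ell q n) (cur q (n - 1) s - cur q n s) s := by
  have h1 := (hq s n).norm_sq
  have hp := one_sub_sq_pos (hb s n)
  have h2 := ((h1.const_sub 1).log hp.ne').neg
  refine h2.congr_deriv ?_
  have key : 2 * inner ℝ (q s n) (ALDeriv q s n)
      = (1 - ‖q s n‖ ^ 2) * (cur q (n - 1) s - cur q n s) := by
    rw [Complex.inner]
    simp only [ALDeriv, cur, sub_add_cancel]
    simp only [Complex.mul_re, Complex.mul_im, Complex.conj_re, Complex.conj_im, Complex.add_re,
      Complex.add_im, Complex.I_re, Complex.I_im, Complex.ofReal_re, Complex.ofReal_im]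
    ring
  rw [key]
  field_simp

lemma cur_le (q : ℝ → ℤ → ℂ) (n : ℤ) (t : ℝ) :
    |cur q n t| ≤ ‖q t n‖ ^ 2 + ‖q t (n + 1)‖ ^ 2 := by
  unfold cur
  rw [abs_mul]
  have h := Complex.abs_im_le_norm ((starRingEnd ℂ) (q t n) * q t (n + 1))
  rw [norm_mul, Complex.norm_conj] at h
  have : |(2 : ℝ)| = 2 := by norm_num
  rw [this]
  nlinarith [sq_nonneg (‖q t n‖ - ‖q t (n + 1)‖)]

lemma sum_by_parts (w j : ℕ → ℝ) (K : ℕ) :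
    ∑ k ∈ Finset.range (K + 1), w k * (j k - j (k + 1))
      = w 0 * j 0 - w K * j (K + 1) + ∑ k ∈ Finset.range K, (w (k + 1) - w k) * j (k + 1) := by
  induction K with
  | zero => simp; ring
  | succ K ih =>
    rw [Finset.sum_range_succ, ih, Finset.sum_range_succ _ K]
    ring

/-- Tent weight, centered at `L`. -/
def tent (L k : ℕ) : ℝ := 1 - |(k : ℝ) - L| / L

lemma tent_zero (L : ℕ) (hL : 0 < L) : tent L 0 = 0 := by
  unfold tent
  have : (0 : ℝ) < L := by exact_mod_cast hL
  simp [this.ne']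

lemma tent_end (L : ℕ) (hL : 0 < L) : tent L (2 * L) = 0 := by
  unfold tent
  have : (0 : ℝ) < L := by exact_mod_cast hL
  have h2 : (((2 * L : ℕ) : ℝ) - L) = L := by push_cast; ring
  rw [h2, abs_of_pos this]
  field_simp; simp

lemma tent_diff (L k : ℕ) (hL : 0 < L) : |tent L (k + 1) - tent L k| ≤ 1 / L := by
  unfold tent
  have h0 : (0 : ℝ) < L := by exact_mod_cast hL
  have h1 : (1 - |((k + 1 : ℕ) : ℝ) - L| / L) - (1 - |(k : ℝ) - L| / L)
      = (|(k : ℝ) - L| - |((k + 1 : ℕ) : ℝ) - L|) / L := by ring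
  rw [h1, abs_div, abs_of_pos h0]
  gcongr
  refine (abs_abs_sub_abs_le _ _).trans ?_
  push_cast
  rw [show (k : ℝ) - L - (k + 1 - L) = -1 by ring]
  simp

lemma tent_le_one (L k : ℕ) : tent L k ≤ 1 := by
  unfold tent
  have : 0 ≤ |(k : ℝ) - L| / L := by positivity
  linarith

lemma tent_nonneg (L k : ℕ) (hL : 0 < L) (hk : k ≤ 2 * L) : 0 ≤ tent L k := by
  unfold tent
  have h0 : (0 : ℝ) < L := by exact_mod_cast hL
  have h1 : (k : ℝ) ≤ 2 * L := by exact_mod_cast hk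
  rw [sub_nonneg, div_le_one h0, abs_le]
  constructor <;> linarith [(Nat.cast_nonneg k : (0 : ℝ) ≤ k)]

/-- Weighted energy -/
def tentE (q : ℝ → ℤ → ℂ) (L : ℕ) (t : ℝ) : ℝ :=
  ∑ k ∈ Finset.range (2 * L + 1), tent L k * ell q ((k : ℤ) - L) t

lemma tentE_deriv (q : ℝ → ℤ → ℂ)
    (hq : ∀ (s : ℝ) (n : ℤ), HasDerivAt (fun u => q u n) (ALDeriv q s n) s)
    (hb : ∀ (s : ℝ) (m : ℤ), ‖q s m‖ < 1) (L : ℕ) (hL : 0 < L) (s : ℝ) :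
    ∃ d, HasDerivAt (tentE q L) d s ∧
      d ≤ (1 / L) * ∑ k ∈ Finset.range (2 * L),
        (‖q s ((k : ℤ) - L)‖ ^ 2 + ‖q s ((k : ℤ) - L + 1)‖ ^ 2) := by
  refine ⟨∑ k ∈ Finset.range (2 * L + 1), tent L k *
    (cur q ((k : ℤ) - L - 1) s - cur q ((k : ℤ) - L) s), ?_, ?_⟩
  · have := HasDerivAt.fun_sum (u := Finset.range (2 * L + 1))
      (A := fun k t => tent L k * ell q ((k : ℤ) - L) t)
      (A' := fun k => tent L k * (cur q ((k : ℤ) - L - 1) s - cur q ((k : ℤ) - L) s)) (x := s)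
      (fun k _ => (ell_deriv q hq hb _ s).const_mul _)
    exact this
  · have h := sum_by_parts (tent L) (fun k => cur q ((k : ℤ) - L - 1) s) (2 * L)
    have e : ∀ k : ℕ, (((k + 1 : ℕ) : ℤ) - L - 1) = (k : ℤ) - L := by intro k; push_cast; ring
    simp only [e] at h
    rw [h, tent_zero L hL, tent_end L hL, zero_mul, zero_mul, sub_zero, zero_add, Finset.mul_sum]
    refine Finset.sum_le_sum fun k _ => ?_
    refine (le_abs_self _).trans ?_
    rw [abs_mul]
    exact mul_le_mul (tent_diff L k hL) (cur_le q _ s) (abs_nonneg _) (by positivity)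

lemma growth {E : ℝ → ℝ} {t C : ℝ} (ht : 0 ≤ t)
    (h : ∀ s, ∃ d, HasDerivAt E d s ∧ (0 ≤ s → s ≤ t → d ≤ C)) : E t ≤ E 0 + C * t := by
  choose d hd hC using h
  have := image_le_of_deriv_right_le_deriv_boundary (f := E) (f' := d) (a := 0) (b := t)
    (B := fun s => E 0 + C * s) (B' := fun _ => C)
    (fun s _ => (hd s).continuousAt.continuousWithinAt)
    (fun s _ => (hd s).hasDerivWithinAt) (by simp)
    (by fun_prop)
    (fun s _ => by
      have := ((hasDerivAt_id s).const_mul C).const_add (E 0)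
      simpa using this.hasDerivWithinAt)
    (fun s hs => hC s hs.1 hs.2.le)
  exact this ⟨ht, le_rfl⟩

/-- conservation: all finite windows at time `t` have energy bounded by the initial energy. -/
lemma conservation (q : ℝ → ℤ → ℂ)
    (hq : ∀ (s : ℝ) (n : ℤ), HasDerivAt (fun u => q u n) (ALDeriv q s n) s)
    (hb : ∀ (s : ℝ) (m : ℤ), ‖q s m‖ < 1) (E0 : ℝ)
    (hE : ∀ L : ℕ, ∑ k ∈ Finset.range (2 * L + 1), ell q ((k : ℤ) - L) 0 ≤ E0)
    (t : ℝ) (ht : 0 ≤ t) (S : Finset ℤ) : ∑ n ∈ S, ell q n t ≤ E0 := by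
  have hnn : ∀ n s, 0 ≤ ell q n s := fun n s => (sq_nonneg _).trans (ell_nonneg' q n s (hb s n))
  have hE0 : 0 ≤ E0 := (Finset.sum_nonneg fun k _ => hnn _ _).trans (hE 0)
  have hinit : ∀ L : ℕ, 0 < L → tentE q L 0 ≤ E0 := by
    intro L hL
    refine le_trans ?_ (hE L)
    refine Finset.sum_le_sum fun k _ => ?_
    exact mul_le_of_le_one_left (hnn _ _) (tent_le_one L k)
  -- crude bound
  have crude : ∀ (L : ℕ), 0 < L → ∀ s, 0 ≤ s → tentE q L s ≤ E0 + 4 * s := by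
    intro L hL s hs
    refine (growth hs (C := 4) fun u => ?_).trans (by linarith [hinit L hL])
    obtain ⟨d, hd, hd'⟩ := tentE_deriv q hq hb L hL u
    refine ⟨d, hd, fun _ _ => hd'.trans ?_⟩
    have h0 : (0 : ℝ) < L := by exact_mod_cast hL
    have : ∑ k ∈ Finset.range (2 * L),
        (‖q u ((k : ℤ) - L)‖ ^ 2 + ‖q u ((k : ℤ) - L + 1)‖ ^ 2) ≤ ∑ k ∈ Finset.range (2 * L), (2 : ℝ) := by
      refine Finset.sum_le_sum fun k _ => ?_
      have h1 := one_sub_sq_pos (hb u ((k : ℤ) - L))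
      have h2 := one_sub_sq_pos (hb u ((k : ℤ) - L + 1))
      linarith
    rw [Finset.sum_const, Finset.card_range] at this
    calc _ ≤ (1 / (L : ℝ)) * ((2 * L) • (2 : ℝ)) := by gcongr
      _ = 4 := by rw [nsmul_eq_mul]; push_cast; field_simp; norm_num
  -- comparison of window sums with tent sums
  have comp : ∀ (K : ℕ) (S : Finset ℤ), (∀ n ∈ S, |n| ≤ K) → ∀ L : ℕ, 0 < L → K ≤ L → ∀ s,
      (1 - (K : ℝ) / L) * ∑ n ∈ S, ell q n s ≤ tentE q L s := by
    intro K S hS L hL hKL s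
    have h0 : (0 : ℝ) < L := by exact_mod_cast hL
    let φ : ℤ → ℕ := fun n => (n + L).toNat
    have hφ : ∀ n ∈ S, ((φ n : ℕ) : ℤ) = n + L := by
      intro n hn
      have := abs_le.1 (hS n hn)
      exact Int.toNat_of_nonneg (by omega)
    have hinj : Set.InjOn φ S := by
      intro a ha b hb' hab
      have h1 := hφ a ha
      have h2 := hφ b hb'
      rw [hab] at h1
      omega
    unfold tentE
    rw [Finset.mul_sum]
    calc _ ≤ ∑ n ∈ S, tent L (φ n) * ell q ((φ n : ℤ) - L) s := by
            refine Finset.sum_le_sum fun n hn => ?_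
            rw [hφ n hn, add_sub_cancel_right]
            refine mul_le_mul_of_nonneg_right ?_ (hnn _ _)
            unfold tent
            have : ((φ n : ℕ) : ℝ) = (n : ℝ) + L := by exact_mod_cast hφ n hn
            rw [this, add_sub_cancel_right]
            have : |(n : ℝ)| ≤ K := by exact_mod_cast hS n hn
            gcongr
      _ = ∑ k ∈ S.image φ, tent L k * ell q ((k : ℤ) - L) s := 
            (Finset.sum_image (f := fun k : ℕ => tent L k * ell q ((k : ℤ) - L) s) hinj).symm
      _ ≤ _ := by
            refine Finset.sum_le_sum_of_subset_of_nonneg ?_ ?_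
            · intro k hk
              obtain ⟨n, hn, rfl⟩ := Finset.mem_image.1 hk
              have h1 := hφ n hn
              have := abs_le.1 (hS n hn)
              rw [Finset.mem_range]
              omega
            · intro k hk _
              rw [Finset.mem_range] at hk
              exact mul_nonneg (tent_nonneg L k hL (by omega)) (hnn _ _)
  -- L² bound on windows
  have l2 : ∀ (S : Finset ℤ) (s : ℝ), 0 ≤ s → s ≤ t →
      ∑ n ∈ S, ‖q s n‖ ^ 2 ≤ 2 * (E0 + 4 * t) := by
    intro S s hs hst
    obtain ⟨K, hK⟩ : ∃ K : ℕ, ∀ n ∈ S, |n| ≤ K := by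
      refine ⟨S.sup (fun n => n.natAbs), fun n hn => ?_⟩
      have := Finset.le_sup (f := fun n : ℤ => n.natAbs) hn
      rw [Int.abs_eq_natAbs]
      exact_mod_cast this
    have h1 := comp (K + 1) S (fun n hn => (hK n hn).trans (by push_cast; omega)) (2 * (K + 1)) (by omega) (by omega) s
    have h2 := crude (2 * (K + 1)) (by omega) s hs
    have h3 : (1 - ((K + 1 : ℕ) : ℝ) / ((2 * (K + 1) : ℕ) : ℝ)) = 1 / 2 := by
      push_cast; field_simp; norm_num
    rw [h3] at h1
    have h4 : ∑ n ∈ S, ‖q s n‖ ^ 2 ≤ ∑ n ∈ S, ell q n s :=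
      Finset.sum_le_sum fun n _ => ell_nonneg' q n s (hb s n)
    linarith
  have fine : ∀ (L : ℕ), 0 < L → tentE q L t ≤ E0 + (1 / (L : ℝ)) * (4 * (E0 + 4 * t)) * t := by
    intro L hL
    refine (growth ht (C := (1 / (L : ℝ)) * (4 * (E0 + 4 * t))) fun u => ?_).trans
      (by linarith [hinit L hL])
    obtain ⟨d, hd, hd'⟩ := tentE_deriv q hq hb L hL u
    refine ⟨d, hd, fun hu hut => hd'.trans ?_⟩
    have a1 := l2 ((Finset.range (2 * L)).image fun k : ℕ => (k : ℤ) - L) u hu hut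
    have a2 := l2 ((Finset.range (2 * L)).image fun k : ℕ => (k : ℤ) - L + 1) u hu hut
    rw [Finset.sum_image (by intro a _ b _ hab; simpa using hab)] at a1 a2
    rw [Finset.sum_add_distrib]
    gcongr
    linarith
  obtain ⟨K, hK⟩ : ∃ K : ℕ, ∀ n ∈ S, |n| ≤ K := by
    refine ⟨S.sup (fun n => n.natAbs), fun n hn => ?_⟩
    have := Finset.le_sup (f := fun n : ℤ => n.natAbs) hn
    rw [Int.abs_eq_natAbs]
    exact_mod_cast this
  have inv0 : Tendsto (fun L : ℕ => (1 : ℝ) / L) atTop (nhds 0) := tendsto_one_div_atTop_nhds_zero_nat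
  have lim1 : Tendsto (fun L : ℕ => (1 - (K : ℝ) * (1 / L)) * ∑ n ∈ S, ell q n t) atTop
      (nhds ((1 - (K : ℝ) * 0) * ∑ n ∈ S, ell q n t)) :=
    ((inv0.const_mul _).const_sub 1).mul_const _
  have lim2 : Tendsto (fun L : ℕ => E0 + (1 / (L : ℝ)) * (4 * (E0 + 4 * t)) * t) atTop
      (nhds (E0 + 0 * (4 * (E0 + 4 * t)) * t)) :=
    ((inv0.mul_const _).mul_const _).const_add _
  have := le_of_tendsto_of_tendsto lim1 lim2 (by
    filter_upwards [eventually_ge_atTop (K + 1)] with L hL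
    have := comp K S hK L (by omega) (by omega) t
    rw [← div_eq_mul_one_div]
    exact this.trans (fine L (by omega)))
  simpa using this

lemma AL_norm_le (q : ℝ → ℤ → ℂ) (hb : ∀ (s : ℝ) (m : ℤ), ‖q s m‖ < 1) (s : ℝ) (n : ℤ) :
    ‖ALDeriv q s n‖ ≤ ‖q s (n - 1)‖ + ‖q s (n + 1)‖ := by
  unfold ALDeriv
  rw [norm_mul, norm_mul, Complex.norm_I, one_mul, Complex.norm_real, Real.norm_eq_abs,
    abs_of_pos (one_sub_sq_pos (hb s n))]
  have : 1 - ‖q s n‖ ^ 2 ≤ 1 := by linarith [sq_nonneg ‖q s n‖]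
  calc _ ≤ 1 * ‖q s (n - 1) + q s (n + 1)‖ := by gcongr
    _ ≤ _ := by rw [one_mul]; exact norm_add_le _ _

/-- super-exponential decay on the left. -/
lemma left_decay (q : ℝ → ℤ → ℂ)
    (hq : ∀ (s : ℝ) (n : ℤ), HasDerivAt (fun u => q u n) (ALDeriv q s n) s)
    (hb : ∀ (s : ℝ) (m : ℤ), ‖q s m‖ < 1)
    (h0 : ∀ n : ℤ, n < 0 → q 0 n = 0) (k : ℕ) :
    ∀ n : ℤ, n ≤ -(k : ℤ) → ∀ s, 0 ≤ s → ‖q s n‖ ≤ (2 * s) ^ k / (k.factorial : ℝ) := by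
  induction k with
  | zero => intro n _ s _; simpa using (hb s n).le
  | succ k ih =>
    intro n hn s hs
    push_cast at hn
    have := image_norm_le_of_norm_deriv_right_le_deriv_boundary (f := fun u => q u n)
      (f' := fun u => ALDeriv q u n) (a := 0) (b := s)
      (B := fun u => (2 * u) ^ (k + 1) / ((k + 1).factorial : ℝ))
      (B' := fun u => 2 * ((2 * u) ^ k / (k.factorial : ℝ)))
      (fun u _ => (hq u n).continuousAt.continuousWithinAt)
      (fun u _ => (hq u n).hasDerivWithinAt) (by simp [h0 n (by omega)])
      (by
        intro u
        have h1 := ((((hasDerivAt_id u).const_mul (2 : ℝ)).pow (k + 1)).div_const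
          ((k + 1).factorial : ℝ))
        refine h1.congr_deriv ?_
        rw [Nat.factorial_succ]
        have : (k.factorial : ℝ) ≠ 0 := by positivity
        push_cast
        simp
        field_simp)
      (by
        intro u hu
        refine (AL_norm_le q hb u n).trans ?_
        have h1 := ih (n - 1) (by omega) u hu.1
        have h2 := ih (n + 1) (by omega) u hu.1
        linarith)
    exact this ⟨hs, le_rfl⟩

/-- inverse Schur step -/
def stp (a z f : ℂ) : ℂ := (a + z * f) / (1 + (starRingEnd ℂ) a * (z * f))

lemma stp_den_ne {a w : ℂ} (ha : ‖a‖ < 1) (hw : ‖w‖ ≤ 1) : 1 + (starRingEnd ℂ) a * w ≠ 0 := by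
  intro h
  have h1 : (starRingEnd ℂ) a * w = -1 := by linear_combination h
  have h2 : ‖a‖ * ‖w‖ = 1 := by
    rw [← Complex.norm_conj a, ← norm_mul, h1]; simp
  nlinarith [norm_nonneg a, norm_nonneg w]

lemma mobius_id (a w : ℂ) : ‖1 + (starRingEnd ℂ) a * w‖ ^ 2 - ‖a + w‖ ^ 2
    = (1 - ‖a‖ ^ 2) * (1 - ‖w‖ ^ 2) := by
  simp only [← Complex.normSq_eq_norm_sq, Complex.normSq_apply, Complex.add_re, Complex.add_im,
    Complex.mul_re, Complex.mul_im, Complex.conj_re, Complex.conj_im, Complex.one_re,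
    Complex.one_im]
  ring

lemma stp_id {a z f : ℂ} (ha : ‖a‖ < 1) (hw : ‖z * f‖ ≤ 1) :
    (1 - ‖stp a z f‖ ^ 2) * ‖1 + (starRingEnd ℂ) a * (z * f)‖ ^ 2
      = (1 - ‖a‖ ^ 2) * (1 - ‖z * f‖ ^ 2) := by
  have h := stp_den_ne ha hw
  have h' : ‖1 + (starRingEnd ℂ) a * (z * f)‖ ≠ 0 := norm_ne_zero_iff.2 h
  rw [← mobius_id, stp, norm_div]
  generalize ‖1 + (starRingEnd ℂ) a * (z * f)‖ = D at h' ⊢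
  field_simp

lemma norm_mul_le_one {z f : ℂ} (hz : ‖z‖ ≤ 1) (hf : ‖f‖ ≤ 1) : ‖z * f‖ ≤ 1 := by
  rw [norm_mul]; exact mul_le_one₀ hz (norm_nonneg _) hf

lemma stp_norm_le {a z f : ℂ} (ha : ‖a‖ < 1) (hw : ‖z * f‖ ≤ 1) : ‖stp a z f‖ ≤ 1 := by
  have h := stp_den_ne ha hw
  rw [stp, norm_div, div_le_one (norm_pos_iff.2 h)]
  have h1 := mobius_id a (z * f)
  have h2 : 0 ≤ (1 - ‖a‖ ^ 2) * (1 - ‖z * f‖ ^ 2) :=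
    mul_nonneg (one_sub_sq_pos ha).le (by nlinarith [norm_nonneg (z * f)])
  exact le_of_sq_le_sq (by linarith) (norm_nonneg _) 

/-- `|stp a z f| ≤ |a| + |z f|` -/
lemma stp_norm_le_add {a z f : ℂ} (ha : ‖a‖ < 1) (hw : ‖z * f‖ ≤ 1) :
    ‖stp a z f‖ ≤ ‖a‖ + ‖z * f‖ := by
  have h := norm_pos_iff.2 (stp_den_ne ha hw)
  have h1 := stp_id ha hw
  set A := ‖a‖
  set W := ‖z * f‖
  set D := ‖1 + (starRingEnd ℂ) a * (z * f)‖
  have hD : D ≤ 1 + A * W := by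
    refine (norm_add_le _ _).trans ?_
    rw [norm_mul, Complex.norm_conj]; simp [A, W]
  have hA : 0 ≤ A := norm_nonneg _
  have hW : 0 ≤ W := norm_nonneg _
  by_contra! hc
  have hS1 := stp_norm_le ha hw
  set S := ‖stp a z f‖
  have h2 : S * (1 + A * W) ≤ A + W := by
    by_contra! h3
    have h4 : (1 - S ^ 2) * D ^ 2 ≤ (1 - S ^ 2) * (1 + A * W) ^ 2 := by
      have : 0 ≤ 1 - S ^ 2 := by nlinarith
      gcongr
    have h5 : (A + W) ^ 2 < (S * (1 + A * W)) ^ 2 := by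
      apply pow_lt_pow_left₀ h3 (by positivity) (by norm_num)
    nlinarith
  have : S * 1 ≤ S * (1 + A * W) := by
    apply mul_le_mul_of_nonneg_left _ (norm_nonneg _)
    nlinarith [mul_nonneg hA hW]
  linarith

/-- Riccati right-hand side -/
def Ric (q : ℤ → ℂ) (n : ℤ) (z f : ℂ) : ℂ :=
  I * (q (n - 1) - q n / z) + (I * (z + 1 / z)
    - I * ((starRingEnd ℂ) (q n) * q (n - 1) + q n * (starRingEnd ℂ) (q (n - 1)))) * f
    + I * ((starRingEnd ℂ) (q (n - 1)) - z * (starRingEnd ℂ) (q n)) * f ^ 2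

/-- chain from the top -/
def fch (q : ℤ → ℂ) (z c : ℂ) (top : ℤ) : ℕ → ℂ
  | 0 => c
  | k + 1 => stp (q (top - 1 - k)) z (fch q z c top k)

lemma fch_norm_le (q : ℤ → ℂ) (hq : ∀ n, ‖q n‖ < 1) {z c : ℂ} (hz : ‖z‖ ≤ 1) (hc : ‖c‖ ≤ 1) (top : ℤ)
    (k : ℕ) : ‖fch q z c top k‖ ≤ 1 := by
  induction k with
  | zero => exact hc
  | succ k ih => exact stp_norm_le (hq _) (norm_mul_le_one hz ih)

lemma ric_step (A A' P P' S S' z f e : ℂ) (hz : z ≠ 0) (hd : 1 + A' * (z * f) ≠ 0) :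
    ((I * (1 - A * A') * (P + S) + z * ((I * (A - S / z) + (I * (z + 1 / z)
      - I * (S' * A + S * A')) * f + I * (A' - z * S') * f ^ 2) + e)) * (1 + A' * (z * f))
      - (A + z * f) * ((-I * (1 - A * A') * (P' + S')) * (z * f) + A' * (z * ((I * (A - S / z) + (I * (z + 1 / z)
      - I * (S' * A + S * A')) * f + I * (A' - z * S') * f ^ 2) + e)))) / (1 + A' * (z * f)) ^ 2
    = (I * (P - A / z) + (I * (z + 1 / z) - I * (A' * P + A * P')) * ((A + z * f) / (1 + A' * (z * f)))
      + I * (P' - z * A') * ((A + z * f) / (1 + A' * (z * f))) ^ 2)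
      + z * (1 - A * A') / (1 + A' * (z * f)) ^ 2 * e := by
  obtain ⟨D, hD⟩ : ∃ D, D = 1 + A' * (z * f) := ⟨_, rfl⟩
  rw [← hD] at hd ⊢
  field_simp
  rw [hD]
  ring

lemma Ric_bound (q : ℤ → ℂ) (hq : ∀ n, ‖q n‖ < 1) (n : ℤ) {z f : ℂ} {r : ℝ} (hr : 0 < r)
    (hz : ‖z‖ = r) (hf : ‖f‖ ≤ 1) : ‖Ric q n z f‖ ≤ 4 + 2 * r + 2 / r := by
  have a := (hq n).le
  have b := (hq (n - 1)).le
  have h1 : ‖I * (q (n - 1) - q n / z)‖ ≤ 1 + 1 / r := by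
    rw [norm_mul, Complex.norm_I, one_mul]
    refine (norm_sub_le _ _).trans ?_
    rw [norm_div, hz]
    gcongr
  have h2 : ‖(I * (z + 1 / z)
    - I * ((starRingEnd ℂ) (q n) * q (n - 1) + q n * (starRingEnd ℂ) (q (n - 1)))) * f‖
      ≤ (r + 1 / r) + (1 * 1 + 1 * 1) := by
    rw [norm_mul]
    refine (mul_le_of_le_one_right (norm_nonneg _) hf).trans ?_
    refine (norm_sub_le _ _).trans ?_
    rw [norm_mul, norm_mul, Complex.norm_I, one_mul, one_mul]
    refine add_le_add ?_ ?_
    · refine (norm_add_le _ _).trans ?_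
      rw [norm_div, hz]; simp
    · refine (norm_add_le _ _).trans ?_
      rw [norm_mul, norm_mul, Complex.norm_conj, Complex.norm_conj]
      gcongr
  have h3 : ‖I * ((starRingEnd ℂ) (q (n - 1)) - z * (starRingEnd ℂ) (q n)) * f ^ 2‖ ≤ 1 + r * 1 := by
    rw [norm_mul, norm_mul, norm_pow, Complex.norm_I, one_mul]
    refine (mul_le_of_le_one_right (norm_nonneg _) (pow_le_one₀ (norm_nonneg _) hf)).trans ?_
    refine (norm_sub_le _ _).trans ?_
    rw [norm_mul, Complex.norm_conj, Complex.norm_conj, hz]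
    gcongr
  unfold Ric
  refine (norm_add_le _ _).trans ?_
  have := (norm_add_le (I * (q (n - 1) - q n / z)) ((I * (z + 1 / z)
    - I * ((starRingEnd ℂ) (q n) * q (n - 1) + q n * (starRingEnd ℂ) (q (n - 1)))) * f))
  have e : 2 / r = 1 / r + 1 / r := by ring
  rw [e]
  linarith

lemma fch_deriv (q : ℝ → ℤ → ℂ)
    (hq : ∀ (s : ℝ) (n : ℤ), HasDerivAt (fun u => q u n) (ALDeriv q s n) s)
    (hb : ∀ (s : ℝ) (m : ℤ), ‖q s m‖ < 1) {z c : ℂ} {r : ℝ} (hr : 0 < r) (hr1 : r < 1)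
    (hz : ‖z‖ = r) (hc : ‖c‖ ≤ 1) (top : ℤ) (s : ℝ) (k : ℕ) :
    ∃ e, HasDerivAt (fun u => fch (q u) z c top k) (Ric (q s) (top - k) z (fch (q s) z c top k) + e) s ∧
      ‖e‖ * (1 - r ^ 2) ≤ r ^ k * (4 + 2 * r + 2 / r) * (1 - r ^ 2 * ‖fch (q s) z c top k‖ ^ 2) := by
  have hz0 : z ≠ 0 := by rw [← norm_pos_iff, hz]; exact hr
  have hr2 : 0 < 1 - r ^ 2 := by nlinarith
  induction k with
  | zero =>
    refine ⟨-Ric (q s) top z c, ?_, ?_⟩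
    · simp only [fch, Nat.cast_zero, sub_zero]
      rw [add_neg_cancel]
      exact hasDerivAt_const s c
    · simp only [fch, norm_neg, pow_zero, one_mul]
      refine mul_le_mul (Ric_bound _ (hb s) _ hr hz hc) ?_ hr2.le (by positivity)
      have : ‖c‖ ^ 2 ≤ 1 := pow_le_one₀ (norm_nonneg _) hc
      nlinarith
  | succ k ih =>
    obtain ⟨e, he, hbd⟩ := ih
    set f := fch (q s) z c top k with hf
    have hf1 : ‖f‖ ≤ 1 := fch_norm_le _ (hb s) (hz.le.trans hr1.le) hc _ _
    set n : ℤ := top - 1 - k with hn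
    have hw : ‖z * f‖ ≤ 1 := norm_mul_le_one (hz.le.trans hr1.le) hf1
    have hd := stp_den_ne (hb s n) hw
    refine ⟨z * (1 - q s n * (starRingEnd ℂ) (q s n)) / (1 + (starRingEnd ℂ) (q s n) * (z * f)) ^ 2 * e, ?_, ?_⟩
    · have e1 : top - ((k + 1 : ℕ) : ℤ) = n := by rw [hn]; push_cast; ring
      have e2 : top - (k : ℤ) = n + 1 := by rw [hn]; ring
      rw [e1]
      rw [e2] at he
      have hqn := hq s n
      have hqc : HasDerivAt (fun u => (starRingEnd ℂ) (q u n)) ((starRingEnd ℂ) (ALDeriv q s n)) s :=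
        hqn.star
      have hzf := he.const_mul z
      have main := (hqn.add hzf).div ((hqc.mul hzf).const_add 1) hd
      refine main.congr_deriv ?_
      have hsq : ((1 - ‖q s n‖ ^ 2 : ℝ) : ℂ) = 1 - q s n * (starRingEnd ℂ) (q s n) := by
        rw [Complex.mul_conj, Complex.normSq_eq_norm_sq]; push_cast; ring
      have key := ric_step (q s n) ((starRingEnd ℂ) (q s n)) (q s (n - 1)) ((starRingEnd ℂ) (q s (n - 1)))
        (q s (n + 1)) ((starRingEnd ℂ) (q s (n + 1))) z f e hz0 hd
      have hAc : (starRingEnd ℂ) (ALDeriv q s n)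
          = -I * (1 - q s n * (starRingEnd ℂ) (q s n)) *
            ((starRingEnd ℂ) (q s (n - 1)) + (starRingEnd ℂ) (q s (n + 1))) := by
        rw [ALDeriv, hsq]
        simp only [map_mul, map_add, map_sub, map_one, Complex.conj_I, Complex.conj_conj]
        ring
      rw [hAc]
      simp only [ALDeriv, hsq, Ric, add_sub_cancel_right, fch, stp]
      simp only [← hf, ← hn]
      exact key
    · have hid := stp_id (hb s n) hw
      change _ ≤ r ^ (k + 1) * (4 + 2 * r + 2 / r) * (1 - r ^ 2 * ‖stp (q s n) z f‖ ^ 2)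
      have hst := stp_norm_le (hb s n) hw
      set D := ‖1 + (starRingEnd ℂ) (q s n) * (z * f)‖ with hD
      have hDpos : 0 < D := norm_pos_iff.2 hd
      have hnq : ‖1 - q s n * (starRingEnd ℂ) (q s n)‖ = 1 - ‖q s n‖ ^ 2 := by
        rw [Complex.mul_conj, Complex.normSq_eq_norm_sq]
        rw [← Complex.ofReal_one, ← Complex.ofReal_sub, Complex.norm_real, Real.norm_eq_abs,
          abs_of_pos (one_sub_sq_pos (hb s n))]
      rw [norm_mul, norm_div, norm_mul, norm_pow, hnq, hz, ← hD]
      have hww : ‖z * f‖ ^ 2 = r ^ 2 * ‖f‖ ^ 2 := by rw [norm_mul, hz]; ring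
      rw [hww] at hid
      have hrf : 0 < 1 - r ^ 2 * ‖f‖ ^ 2 := by
        have : ‖f‖ ^ 2 ≤ 1 := pow_le_one₀ (norm_nonneg _) hf1
        nlinarith
      set T := 1 - ‖stp (q s n) z f‖ ^ 2 with hT
      have hT0 : 0 ≤ T := by
        have : ‖stp (q s n) z f‖ ^ 2 ≤ 1 := pow_le_one₀ (norm_nonneg _) hst
        linarith
      have h1 : (1 - ‖q s n‖ ^ 2) = T * D ^ 2 / (1 - r ^ 2 * ‖f‖ ^ 2) := by
        rw [eq_div_iff hrf.ne', hid]
      rw [h1]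
      have h2 : r * (T * D ^ 2 / (1 - r ^ 2 * ‖f‖ ^ 2)) / D ^ 2 * ‖e‖ * (1 - r ^ 2)
          = r * T * ((‖e‖ * (1 - r ^ 2)) / (1 - r ^ 2 * ‖f‖ ^ 2)) := by
        field_simp
      rw [h2]
      have h3 : (‖e‖ * (1 - r ^ 2)) / (1 - r ^ 2 * ‖f‖ ^ 2) ≤ r ^ k * (4 + 2 * r + 2 / r) := by
        rw [div_le_iff₀ hrf]; exact hbd
      calc _ ≤ r * T * (r ^ k * (4 + 2 * r + 2 / r)) := by gcongr
        _ = r ^ (k + 1) * (4 + 2 * r + 2 / r) * T := by ring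
        _ ≤ _ := by
          gcongr
          rw [hT]
          have : ‖stp (q s n) z f‖ ^ 2 * r ^ 2 ≤ ‖stp (q s n) z f‖ ^ 2 * 1 := by
            gcongr; nlinarith
          linarith

lemma Ric_small (q : ℤ → ℂ) (hq : ∀ n, ‖q n‖ < 1) (n : ℤ) {z f : ℂ} {r ε : ℝ} (hr : 0 < r)
    (hr1 : r < 1) (hz : ‖z‖ = r) (hf : ‖f‖ ≤ 1) (h1 : ‖q n‖ ≤ ε) (h2 : ‖q (n - 1)‖ ≤ ε) :
    ‖Ric q n z f - I * (z + 1 / z) * f‖ ≤ ε * (5 + 1 / r) := by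
  have hε : 0 ≤ ε := (norm_nonneg _).trans h1
  have a := (hq n).le
  have b := (hq (n - 1)).le
  have e : Ric q n z f - I * (z + 1 / z) * f = I * (q (n - 1) - q n / z)
    - (I * ((starRingEnd ℂ) (q n) * q (n - 1) + q n * (starRingEnd ℂ) (q (n - 1)))) * f
    + I * ((starRingEnd ℂ) (q (n - 1)) - z * (starRingEnd ℂ) (q n)) * f ^ 2 := by
    unfold Ric; ring
  have h1 : ‖I * (q (n - 1) - q n / z)‖ ≤ ε + ε / r := by
    rw [norm_mul, Complex.norm_I, one_mul]
    refine (norm_sub_le _ _).trans ?_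
    rw [norm_div, hz]
    gcongr
  have h2 : ‖(I * ((starRingEnd ℂ) (q n) * q (n - 1) + q n * (starRingEnd ℂ) (q (n - 1)))) * f‖
      ≤ (ε * 1 + ε * 1) := by
    rw [norm_mul]
    refine (mul_le_of_le_one_right (norm_nonneg _) hf).trans ?_
    rw [norm_mul, Complex.norm_I, one_mul]
    refine (norm_add_le _ _).trans ?_
    rw [norm_mul, norm_mul, Complex.norm_conj, Complex.norm_conj]
    gcongr
  have h3 : ‖I * ((starRingEnd ℂ) (q (n - 1)) - z * (starRingEnd ℂ) (q n)) * f ^ 2‖ ≤ ε + 1 * ε := by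
    rw [norm_mul, norm_mul, norm_pow, Complex.norm_I, one_mul]
    refine (mul_le_of_le_one_right (norm_nonneg _) (pow_le_one₀ (norm_nonneg _) hf)).trans ?_
    refine (norm_sub_le _ _).trans ?_
    rw [norm_mul, Complex.norm_conj, Complex.norm_conj, hz]
    gcongr
  rw [e]
  refine (norm_add_le _ _).trans ?_
  have h4 := (norm_sub_le (I * (q (n - 1) - q n / z))
    ((I * ((starRingEnd ℂ) (q n) * q (n - 1) + q n * (starRingEnd ℂ) (q (n - 1)))) * f))
  have e2 : ε * (5 + 1 / r) = 5 * ε + ε / r := by ring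
  rw [e2]
  linarith

lemma re_mu_le {z : ℂ} {r : ℝ} (hr : 0 < r) (hr1 : r < 1) (hz : ‖z‖ = r) :
    (I * (z + 1 / z)).re ≤ 1 / r := by
  have h1 : (I * (z + 1 / z)).re = z.im * (1 / r ^ 2 - 1) := by
    simp [Complex.mul_re, Complex.inv_im, Complex.normSq_eq_norm_sq, hz]
    ring
  rw [h1]
  have h2 : z.im ≤ r := hz ▸ (le_abs_self _).trans (Complex.abs_im_le_norm z)
  have h3 : 0 ≤ 1 / r ^ 2 - 1 := by
    rw [sub_nonneg, le_div_iff₀ (by positivity)]; nlinarith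
  calc _ ≤ r * (1 / r ^ 2 - 1) := by gcongr
    _ = 1 / r - r := by field_simp
    _ ≤ _ := by linarith

lemma norm_mu_le {z : ℂ} {r : ℝ} (hz : ‖z‖ = r) : ‖I * (z + 1 / z)‖ ≤ r + 1 / r := by
  rw [norm_mul, Complex.norm_I, one_mul]
  refine (norm_add_le _ _).trans ?_
  rw [norm_div, hz]; simp

lemma linear_evol {μ : ℂ} {δ S : ℝ → ℂ} {t R K S0 : ℝ} (ht : 0 ≤ t)
    (hμ : μ.re ≤ R) (hK : ‖μ‖ ≤ K) (_hS0 : 0 ≤ S0)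
    (hδ : ∀ s, HasDerivAt δ (μ * δ s + S s) s) (hS : ∀ s, 0 ≤ s → s ≤ t → ‖S s‖ ≤ S0) :
    ‖δ t‖ ≤ Real.exp (t * R) * (‖δ 0‖ + t * (Real.exp (t * K) * S0)) := by
  have hlin : ∀ s : ℝ, HasDerivAt (fun u : ℝ => -μ * (u : ℂ)) (-μ) s := by
    intro s
    simpa using (Complex.ofRealCLM.hasDerivAt (x := s)).const_mul (-μ)
  have hu : ∀ s : ℝ, HasDerivAt (fun u : ℝ => Complex.exp (-μ * u) * δ u)
      (Complex.exp (-μ * s) * S s) s := by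
    intro s
    refine ((hlin s).cexp.mul (hδ s)).congr_deriv ?_
    ring
  have hbd : ∀ s ∈ Set.Ico (0 : ℝ) t, ‖Complex.exp (-μ * s) * S s‖ ≤ Real.exp (t * K) * S0 := by
    intro s hs
    rw [norm_mul]
    have h1 : ‖Complex.exp (-μ * s)‖ ≤ Real.exp (t * K) := by
      refine (Complex.norm_exp_le_exp_norm _).trans ?_
      rw [Real.exp_le_exp, norm_mul, norm_neg, Complex.norm_real, Real.norm_of_nonneg hs.1, mul_comm]
      exact mul_le_mul hs.2.le hK (norm_nonneg _) ht
    exact mul_le_mul h1 (hS s hs.1 hs.2.le) (norm_nonneg _) (Real.exp_nonneg _)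
  have hm := norm_image_sub_le_of_norm_deriv_le_segment' (a := 0) (b := t)
    (fun s _ => (hu s).hasDerivWithinAt) hbd t ⟨ht, le_rfl⟩
  simp only [Complex.ofReal_zero, mul_zero, Complex.exp_zero, one_mul, sub_zero] at hm
  have hU : ‖Complex.exp (-μ * t) * δ t‖ ≤ ‖δ 0‖ + t * (Real.exp (t * K) * S0) := by
    have := norm_le_norm_add_norm_sub' (Complex.exp (-μ * t) * δ t) (δ 0)
    linarith
  have hδt : δ t = Complex.exp (μ * t) * (Complex.exp (-μ * t) * δ t) := by
    rw [← mul_assoc, ← Complex.exp_add]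
    simp
  rw [hδt, norm_mul]
  refine mul_le_mul ?_ hU (norm_nonneg _) (Real.exp_nonneg _)
  rw [Complex.norm_exp, Real.exp_le_exp]
  simp only [Complex.mul_re, Complex.ofReal_re, Complex.ofReal_im, mul_zero, sub_zero]
  rw [mul_comm]
  gcongr

lemma delta_evol (qF qG : ℝ → ℤ → ℂ)
    (hqF : ∀ (s : ℝ) (n : ℤ), HasDerivAt (fun u => qF u n) (ALDeriv qF s n) s)
    (hqG : ∀ (s : ℝ) (n : ℤ), HasDerivAt (fun u => qG u n) (ALDeriv qG s n) s)
    (hbF : ∀ (s : ℝ) (m : ℤ), ‖qF s m‖ < 1) (hbG : ∀ (s : ℝ) (m : ℤ), ‖qG s m‖ < 1)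
    {z c d : ℂ} {r ε t : ℝ} (ht : 0 ≤ t) (hr : 0 < r) (hr1 : r < 1)
    (hz : ‖z‖ = r) (hc : ‖c‖ ≤ 1) (hd : ‖d‖ ≤ 1) (top : ℤ) (k : ℕ)
    (hF : ∀ s, 0 ≤ s → s ≤ t → ∀ n, n ≤ top - k → ‖qF s n‖ ≤ ε)
    (hG : ∀ s, 0 ≤ s → s ≤ t → ∀ n, n ≤ top - k → ‖qG s n‖ ≤ ε) :
    ‖fch (qF t) z c top k - fch (qG t) z d top k‖ ≤ Real.exp (t / r) *
      (‖fch (qF 0) z c top k - fch (qG 0) z d top k‖ + t * (Real.exp (t * (r + 1 / r)) *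
        (2 * (ε * (5 + 1 / r) + r ^ k * ((4 + 2 * r + 2 / r) / (1 - r ^ 2)))))) := by
  have hε : 0 ≤ ε := (norm_nonneg _).trans (hF 0 le_rfl ht _ le_rfl)
  have hr2 : 0 < 1 - r ^ 2 := by nlinarith
  have aux : ∀ (q : ℝ → ℤ → ℂ) (hq : ∀ (s : ℝ) (n : ℤ), HasDerivAt (fun u => q u n) (ALDeriv q s n) s)
    (hb : ∀ (s : ℝ) (m : ℤ), ‖q s m‖ < 1) (c : ℂ) (hc : ‖c‖ ≤ 1)
    (hF : ∀ s, 0 ≤ s → s ≤ t → ∀ n, n ≤ top - k → ‖q s n‖ ≤ ε) (s : ℝ), ∃ S,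
      HasDerivAt (fun u => fch (q u) z c top k) (I * (z + 1 / z) * fch (q s) z c top k + S) s ∧
      (0 ≤ s → s ≤ t → ‖S‖ ≤ ε * (5 + 1 / r) + r ^ k * ((4 + 2 * r + 2 / r) / (1 - r ^ 2))) := by
    intro q hq hb c hc hF s
    obtain ⟨e, he, hbd⟩ := fch_deriv q hq hb hr hr1 hz hc top s k
    have hf1 := fch_norm_le (q s) (hb s) (hz.le.trans hr1.le) hc top k
    set f := fch (q s) z c top k
    refine ⟨(Ric (q s) (top - k) z f - I * (z + 1 / z) * f) + e, ?_, ?_⟩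
    · convert he using 1; ring
    · intro hs hst
      refine (norm_add_le _ _).trans (add_le_add ?_ ?_)
      · exact Ric_small (q s) (hb s) _ hr hr1 hz hf1 (hF s hs hst _ le_rfl) (hF s hs hst _ (by omega))
      · rw [← mul_div_assoc, le_div_iff₀ hr2]
        refine hbd.trans (mul_le_of_le_one_right (by positivity) ?_)
        have : 0 ≤ r ^ 2 * ‖f‖ ^ 2 := by positivity
        linarith
  choose S hS hSb using aux qF hqF hbF c hc hF
  choose T hT hTb using aux qG hqG hbG d hd hG
  have := linear_evol (μ := I * (z + 1 / z))
    (δ := fun u => fch (qF u) z c top k - fch (qG u) z d top k) (S := fun s => S s - T s)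
    (t := t) (R := 1 / r) (K := r + 1 / r)
    (S0 := 2 * (ε * (5 + 1 / r) + r ^ k * ((4 + 2 * r + 2 / r) / (1 - r ^ 2)))) ht
    (re_mu_le hr hr1 hz) (norm_mu_le hz) (by positivity)
    (fun s => by
      refine ((hS s).sub (hT s)).congr_deriv ?_
      ring)
    (fun s hs hst => by
      refine (norm_sub_le _ _).trans ?_
      linarith [hSb s hs hst, hTb s hs hst])
  rw [mul_one_div] at this
  exact this

open MeasureTheory in
lemma mean_norm_le {μ : Measure ℝ} [IsProbabilityMeasure μ] {u : ℝ → ℂ} (hu : MemLp u 2 μ) :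
    ‖∫ x, u x ∂μ‖ₑ ≤ eLpNorm u 2 μ := by
  refine (enorm_integral_le_lintegral_enorm _).trans ?_
  rw [← eLpNorm_one_eq_lintegral_enorm]
  exact eLpNorm_le_eLpNorm_of_exponent_le (by norm_num) hu.1

open MeasureTheory in
lemma sub_mean_le {μ : Measure ℝ} [IsProbabilityMeasure μ] {u : ℝ → ℂ} (hu : MemLp u 2 μ) :
    eLpNorm (fun x => u x - ∫ y, u y ∂μ) 2 μ ≤ eLpNorm u 2 μ := by
  set c := ∫ y, u y ∂μ with hc
  have hi : Integrable u μ := hu.integrable (by norm_num)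
  have hu2 : MemLp (fun x => u x - c) 2 μ := hu.sub (memLp_const c)
  rw [hu2.eLpNorm_eq_integral_rpow_norm (by norm_num) (by norm_num),
    hu.eLpNorm_eq_integral_rpow_norm (by norm_num) (by norm_num)]
  apply ENNReal.ofReal_le_ofReal
  simp only [ENNReal.toReal_ofNat, Real.rpow_ofNat]
  refine Real.rpow_le_rpow (integral_nonneg fun x => by positivity) ?_ (by norm_num)
  have hs : Integrable (fun x => ‖u x‖ ^ 2) μ := by
    simpa using hu.integrable_norm_pow (by norm_num)
  have hre : Integrable (fun x => 2 * ((starRingEnd ℂ) c * u x).re) μ :=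
    ((hi.const_mul _).re).const_mul 2
  have e : ∀ x, ‖u x - c‖ ^ 2 = (‖u x‖ ^ 2 - 2 * ((starRingEnd ℂ) c * u x).re) + ‖c‖ ^ 2 := by
    intro x
    simp only [← Complex.normSq_eq_norm_sq, Complex.normSq_apply, Complex.sub_re, Complex.sub_im,
      Complex.mul_re, Complex.conj_re, Complex.conj_im]
    ring
  have hre2 : ∫ x, 2 * ((starRingEnd ℂ) c * u x).re ∂μ = 2 * ‖c‖ ^ 2 := by
    rw [integral_const_mul]
    have h1 : ∫ x, ((starRingEnd ℂ) c * u x).re ∂μ = (∫ x, (starRingEnd ℂ) c * u x ∂μ).re :=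
      integral_re (hi.const_mul ((starRingEnd ℂ) c))
    rw [h1, integral_const_mul, ← hc]
    simp only [← Complex.normSq_eq_norm_sq, Complex.normSq_apply, 
      Complex.mul_re, Complex.conj_re, Complex.conj_im]
    ring
  simp only [e]
  have hsub : Integrable (fun x => ‖u x‖ ^ 2 - 2 * ((starRingEnd ℂ) c * u x).re) μ := hs.sub hre
  rw [integral_add hsub (integrable_const _), integral_sub hs hre, hre2]
  simp only [integral_const, probReal_univ, one_smul]
  nlinarith [sq_nonneg ‖c‖]

open MeasureTheory in
lemma l2_step {μ : Measure ℝ} [IsProbabilityMeasure μ] {u v : ℝ → ℂ} (hu : MemLp u 2 μ)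
    {Λ w₁ w₂ : ℝ} (hΛ : 0 ≤ Λ) (h1 : 0 ≤ w₁) (h2 : 0 ≤ w₂)
    (h : ∀ x, ‖v x‖ ≤ Λ * (‖u x - ∫ y, u y ∂μ‖ + w₁ * ‖∫ y, u y ∂μ‖ + w₂ * ‖u x‖)) :
    eLpNorm v 2 μ ≤ ENNReal.ofReal (Λ * (1 + w₁ + w₂)) * eLpNorm u 2 μ := by
  set c := ∫ y, u y ∂μ with hc
  have hu2 : MemLp (fun x => u x - c) 2 μ := hu.sub (memLp_const c)
  refine (eLpNorm_mono_real h).trans ?_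
  have e1 : (fun x => Λ * (‖u x - c‖ + w₁ * ‖c‖ + w₂ * ‖u x‖))
      = Λ • (((fun x => ‖u x - c‖) + (fun _ => w₁ * ‖c‖)) + w₂ • (fun x => ‖u x‖)) := by
    ext x; simp
  rw [e1, eLpNorm_const_smul, ENNReal.ofReal_mul hΛ, Real.enorm_of_nonneg hΛ, mul_assoc]
  gcongr
  have m1 : AEStronglyMeasurable (fun x => ‖u x - c‖) μ := hu2.1.norm
  have m2 : AEStronglyMeasurable (fun _ : ℝ => w₁ * ‖c‖) μ := aestronglyMeasurable_const
  have m3 : AEStronglyMeasurable (w₂ • (fun x => ‖u x‖)) μ := hu.1.norm.const_smul w₂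
  refine (eLpNorm_add_le (m1.add m2) m3 (by norm_num)).trans ?_
  rw [ENNReal.ofReal_add (by positivity) h2, ENNReal.ofReal_add (by positivity) h1, add_mul, add_mul]
  refine add_le_add ((eLpNorm_add_le m1 m2 (by norm_num)).trans (add_le_add ?_ ?_)) ?_
  · rw [eLpNorm_norm, ENNReal.ofReal_one, one_mul]
    exact sub_mean_le hu
  · rw [eLpNorm_const _ (by norm_num) (IsProbabilityMeasure.ne_zero μ)]
    simp only [measure_univ, ENNReal.one_rpow, mul_one]
    rw [Real.enorm_of_nonneg (by positivity), ENNReal.ofReal_mul h1]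
    gcongr
    rw [ofReal_norm]
    exact mean_norm_le hu
  · rw [eLpNorm_const_smul, eLpNorm_norm, Real.enorm_of_nonneg h2]

/-- normalized Lebesgue measure on `(0, 2π]` -/
def circM : MeasureTheory.Measure ℝ :=
  (ENNReal.ofReal (2 * Real.pi))⁻¹ • MeasureTheory.volume.restrict (Set.Ioc 0 (2 * Real.pi))

instance : MeasureTheory.IsProbabilityMeasure circM := by
  constructor
  unfold circM
  simp only [MeasureTheory.Measure.smul_apply, MeasureTheory.Measure.restrict_apply_univ,
    Real.volume_Ioc, sub_zero, smul_eq_mul]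
  refine ENNReal.inv_mul_cancel ?_ ENNReal.ofReal_ne_top
  simp [Real.pi_pos]

open MeasureTheory in
lemma circM_integral (f : ℂ → ℂ) (r : ℝ) :
    ∫ θ, f (circleMap 0 r θ) ∂circM = Real.circleAverage f 0 r := by
  unfold circM
  rw [integral_smul_measure, Real.circleAverage_def, intervalIntegral.integral_of_le (by positivity)]
  congr 1
  rw [ENNReal.toReal_inv, ENNReal.toReal_ofReal (by positivity)]

lemma diffContOnCl_of {f : ℂ → ℂ} (hf : DifferentiableOn ℂ f (ball 0 1)) {r : ℝ} (hr : 0 < r)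
    (hr1 : r < 1) : DiffContOnCl ℂ f (ball 0 |r|) := by
  rw [abs_of_pos hr]
  exact (hf.mono (closedBall_subset_ball hr1)).diffContOnCl_ball Set.Subset.rfl

lemma circ_mem {r : ℝ} (hr : 0 < r) (hr1 : r < 1) (θ : ℝ) : circleMap 0 r θ ∈ ball (0 : ℂ) 1 := by
  simp [abs_of_pos hr, hr1]

open MeasureTheory in
lemma circ_memLp {f : ℂ → ℂ} (hf : DifferentiableOn ℂ f (ball 0 1)) {r : ℝ} (hr : 0 < r)
    (hr1 : r < 1) {C : ℝ} (hC : ∀ z ∈ ball (0 : ℂ) 1, ‖f z‖ ≤ C) :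
    MemLp (fun θ => f (circleMap 0 r θ)) 2 circM := by
  refine MemLp.of_bound (C := C) ?_ (Eventually.of_forall fun θ => hC _ (circ_mem hr hr1 θ))
  apply Continuous.aestronglyMeasurable
  exact hf.continuousOn.comp_continuous (continuous_circleMap 0 r) (circ_mem hr hr1)

/-- L² norm on the circle of radius `r`. -/
def N2 (r : ℝ) (f : ℂ → ℂ) : ENNReal :=
  MeasureTheory.eLpNorm (fun θ => f (circleMap 0 r θ)) 2 circM

lemma circ_mean {f : ℂ → ℂ} (hf : DifferentiableOn ℂ f (ball 0 1)) {r : ℝ} (hr : 0 < r)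
    (hr1 : r < 1) : ∫ θ, f (circleMap 0 r θ) ∂circM = f 0 := by
  rw [circM_integral]
  exact (diffContOnCl_of hf hr hr1).circleAverage

lemma N2_zero_le {f : ℂ → ℂ} (hf : DifferentiableOn ℂ f (ball 0 1)) {r : ℝ} (hr : 0 < r)
    (hr1 : r < 1) {C : ℝ} (hC : ∀ z ∈ ball (0 : ℂ) 1, ‖f z‖ ≤ C) : ‖f 0‖ₑ ≤ N2 r f := by
  have := mean_norm_le (circ_memLp hf hr hr1 hC)
  rwa [circ_mean hf hr hr1] at this

lemma N2_le {f : ℂ → ℂ} {r C : ℝ} (hr : 0 < r) (hC : ∀ z, ‖z‖ = r → ‖f z‖ ≤ C) :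
    N2 r f ≤ ENNReal.ofReal C := by
  refine (MeasureTheory.eLpNorm_le_of_ae_bound (C := C)
    (Eventually.of_forall fun θ => hC _ (by simp [abs_of_pos hr]))).trans ?_
  simp

lemma den_inv_le {a f : ℂ} {x κ : ℝ} (hf : ‖f‖ ≤ 1) (hfx : ‖f‖ ≤ x) (hκ0 : 0 < κ)
    (hκ : 1 / κ ≤ 1 - ‖a‖) : ‖(1 - (starRingEnd ℂ) a * f)‖⁻¹ ≤ Real.exp (κ * (‖a‖ * x)) ∧
      1 - (starRingEnd ℂ) a * f ≠ 0 := by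
  have hk : 0 < 1 / κ := by positivity
  have ha : ‖a‖ < 1 := by linarith
  set v := ‖a‖ * ‖f‖ with hv
  have hv0 : 0 ≤ v := by positivity
  have hva : v ≤ ‖a‖ := mul_le_of_le_one_right (norm_nonneg _) hf
  have h1 : 1 - v ≤ ‖1 - (starRingEnd ℂ) a * f‖ := by
    have := norm_sub_norm_le (1 : ℂ) ((starRingEnd ℂ) a * f)
    rw [norm_mul, Complex.norm_conj, norm_one] at this
    exact this
  have h2 : 0 < 1 - v := by linarith
  refine ⟨?_, fun h => by rw [h, norm_zero] at h1; linarith⟩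
  calc _ ≤ (1 - v)⁻¹ := by gcongr
    _ ≤ 1 + κ * v := by
      rw [inv_le_iff_one_le_mul₀ h2]
      have : 1 ≤ κ * (1 - v) := by
        rw [div_le_iff₀ hκ0] at hκ
        nlinarith
      nlinarith
    _ ≤ Real.exp (κ * v) := by linarith [Real.add_one_le_exp (κ * v)]
    _ ≤ _ := by
      rw [Real.exp_le_exp, hv]
      gcongr

lemma schur_diff {f g a b f' g' z : ℂ} 
    (hf : z * f' * (1 - (starRingEnd ℂ) a * f) = f - a)
    (hg : z * g' * (1 - (starRingEnd ℂ) b * g) = g - b) :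
    z * (f' - g') * ((1 - (starRingEnd ℂ) a * f) * (1 - (starRingEnd ℂ) b * g))
      = ((f - g) - (a - b)) + ((starRingEnd ℂ) (a - b) * ((f - a) * g)
        + (starRingEnd ℂ) a * (a - b) * g) - (starRingEnd ℂ) a * b * (f - g) := by
  have : z * (f' - g') * ((1 - (starRingEnd ℂ) a * f) * (1 - (starRingEnd ℂ) b * g))
    = (z * f' * (1 - (starRingEnd ℂ) a * f)) * (1 - (starRingEnd ℂ) b * g)
      - (z * g' * (1 - (starRingEnd ℂ) b * g)) * (1 - (starRingEnd ℂ) a * f) := by ring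
  rw [this, hf, hg, map_sub]
  ring

lemma schur_step {f g f' g' : ℂ → ℂ} {r κ x y : ℝ} (hr : 0 < r) (hr1 : r < 1)
    (hf : DifferentiableOn ℂ f (ball 0 1)) (hg : DifferentiableOn ℂ g (ball 0 1))
    (hf1 : ∀ z ∈ ball (0 : ℂ) 1, ‖f z‖ ≤ 1) (hg1 : ∀ z ∈ ball (0 : ℂ) 1, ‖g z‖ ≤ 1)
    (hff : ∀ z ∈ ball (0 : ℂ) 1, z * f' z * (1 - (starRingEnd ℂ) (f 0) * f z) = f z - f 0)
    (hgg : ∀ z ∈ ball (0 : ℂ) 1, z * g' z * (1 - (starRingEnd ℂ) (g 0) * g z) = g z - g 0)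
    (hx : ∀ z, ‖z‖ = r → ‖f z‖ ≤ x) (hy : ∀ z, ‖z‖ = r → ‖g z‖ ≤ y)
    (hκ0 : 0 < κ) (hκa : 1 / κ ≤ 1 - ‖f 0‖) (hκb : 1 / κ ≤ 1 - ‖g 0‖) :
    N2 r (fun z => f' z - g' z) ≤ ENNReal.ofReal (r⁻¹ * Real.exp (κ * (‖f 0‖ * x + ‖g 0‖ * y)
      + (x * y + 2 * ‖f 0‖ * y + ‖f 0‖ * ‖g 0‖))) * N2 r (fun z => f z - g z) := by
  have hx0 : 0 ≤ x := (norm_nonneg _).trans (hx r (by simp [abs_of_pos hr]))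
  have hy0 : 0 ≤ y := (norm_nonneg _).trans (hy r (by simp [abs_of_pos hr]))
  have hm := circ_memLp (f := fun z => f z - g z) (hf.sub hg) hr hr1 (C := 2)
    (fun z hz => (norm_sub_le _ _).trans (by linarith [hf1 z hz, hg1 z hz]))
  have hmean := circ_mean (f := fun z => f z - g z) (hf.sub hg) hr hr1
  set a := f 0
  set b := g 0
  have main := l2_step (v := fun θ => f' (circleMap 0 r θ) - g' (circleMap 0 r θ)) hm
    (Λ := r⁻¹ * (Real.exp (κ * (‖a‖ * x)) * Real.exp (κ * (‖b‖ * y))))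
    (w₁ := x * y + 2 * ‖a‖ * y) (w₂ := ‖a‖ * ‖b‖) (by positivity) (by positivity) (by positivity) ?_
  · refine main.trans ?_
    unfold N2
    gcongr ENNReal.ofReal ?_ * _
    rw [Real.exp_add, mul_add κ, Real.exp_add, mul_assoc]
    gcongr
    have := Real.add_one_le_exp (x * y + 2 * ‖a‖ * y + ‖a‖ * ‖b‖)
    linarith
  · intro θ
    rw [hmean]
    set z := circleMap 0 r θ
    have hzr : ‖z‖ = r := by simp [z, abs_of_pos hr]
    have hzb : z ∈ ball (0 : ℂ) 1 := circ_mem hr hr1 θ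
    have hd := schur_diff (hff z hzb) (hgg z hzb)
    obtain ⟨d1, n1⟩ := den_inv_le (hf1 z hzb) (hx z hzr) hκ0 hκa
    obtain ⟨d2, n2⟩ := den_inv_le (hg1 z hzb) (hy z hzr) hκ0 hκb
    have hn := congrArg norm hd
    rw [norm_mul, norm_mul, norm_mul, hzr] at hn
    set D1 := ‖1 - (starRingEnd ℂ) a * f z‖
    set D2 := ‖1 - (starRingEnd ℂ) b * g z‖
    have D1p : 0 < D1 := norm_pos_iff.2 n1
    have D2p : 0 < D2 := norm_pos_iff.2 n2
    have e : ‖f' z - g' z‖ = r⁻¹ * (D1⁻¹ * D2⁻¹) * (r * ‖f' z - g' z‖ * (D1 * D2)) := by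
      field_simp
    rw [e, hn]
    have hfx := hx z hzr
    have hgy := hy z hzr
    refine mul_le_mul (by gcongr) ?_ (norm_nonneg _) (by positivity)
    refine (norm_sub_le _ _).trans (add_le_add ((norm_add_le _ _).trans (add_le_add le_rfl ?_)) ?_)
    · have t1 : ‖(starRingEnd ℂ) (a - b) * ((f z - a) * g z)‖ ≤ ‖a - b‖ * ((x + ‖a‖) * y) := by
        rw [norm_mul, norm_mul, Complex.norm_conj]
        have := (norm_sub_le (f z) a).trans (add_le_add hfx le_rfl)
        gcongr
      have t2 : ‖(starRingEnd ℂ) a * (a - b) * g z‖ ≤ ‖a‖ * ‖a - b‖ * y := by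
        rw [norm_mul, norm_mul, Complex.norm_conj]
        gcongr
      refine (norm_add_le _ _).trans ((add_le_add t1 t2).trans (le_of_eq ?_))
      ring
    · rw [norm_mul, norm_mul, Complex.norm_conj]

lemma fch_diff (q : ℤ → ℂ) (hq : ∀ n, ‖q n‖ < 1) {c : ℂ → ℂ}
    (hc : DifferentiableOn ℂ c (ball 0 1)) (hc1 : ∀ z ∈ ball (0 : ℂ) 1, ‖c z‖ ≤ 1) (top : ℤ) (k : ℕ) :
    DifferentiableOn ℂ (fun z => fch q z (c z) top k) (ball 0 1) := by
  induction k with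
  | zero => exact hc
  | succ k ih =>
    have hzf : DifferentiableOn ℂ (fun z => z * fch q z (c z) top k) (ball 0 1) :=
      differentiableOn_id.mul ih
    refine DifferentiableOn.div (hzf.const_add _) ((hzf.const_mul _).const_add _) ?_
    intro z hz
    have hz1 : ‖z‖ ≤ 1 := by simpa using (mem_ball_zero_iff.1 hz).le
    exact stp_den_ne (hq _) (norm_mul_le_one hz1 (fch_norm_le q hq hz1 (hc1 z hz) top k))

lemma fch_zero (q : ℤ → ℂ) (c : ℂ) (top : ℤ) (k : ℕ) : fch q 0 c top (k + 1) = q (top - 1 - k) := by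
  simp [fch, stp]

lemma stp_rel {a z f : ℂ} (ha : ‖a‖ < 1) (hw : ‖z * f‖ ≤ 1) :
    z * f * (1 - (starRingEnd ℂ) a * stp a z f) = stp a z f - a := by
  have hd := stp_den_ne ha hw
  unfold stp
  obtain ⟨D, hD⟩ : ∃ D, D = 1 + (starRingEnd ℂ) a * (z * f) := ⟨_, rfl⟩
  rw [← hD] at hd ⊢
  field_simp
  rw [hD]
  ring

lemma stp_of_rel {a z f g : ℂ} (ha : ‖a‖ < 1) (hw : ‖z * f‖ ≤ 1)
    (h : z * f * (1 - (starRingEnd ℂ) a * g) = g - a) : g = stp a z f := by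
  unfold stp
  rw [eq_div_iff (stp_den_ne ha hw)]
  linear_combination -h

/-- majorant -/
def maj (q : ℤ → ℂ) (r s : ℝ) (top : ℤ) : ℕ → ℝ
  | 0 => s
  | k + 1 => ‖q (top - 1 - k)‖ + r * maj q r s top k

lemma fch_maj (q : ℤ → ℂ) (hq : ∀ n, ‖q n‖ < 1) {z c : ℂ} {r s : ℝ} (hz : ‖z‖ = r) (hr1 : r < 1)
    (hc : ‖c‖ ≤ 1) (hs : ‖c‖ ≤ s) (top : ℤ) (k : ℕ) : ‖fch q z c top k‖ ≤ maj q r s top k := by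
  have hz1 : ‖z‖ ≤ 1 := hz.le.trans hr1.le
  induction k with
  | zero => exact hs
  | succ k ih =>
    refine (stp_norm_le_add (hq _) (norm_mul_le_one hz1 (fch_norm_le q hq hz1 hc top k))).trans ?_
    rw [norm_mul, hz]
    have : 0 ≤ r := hz ▸ norm_nonneg z
    unfold maj
    gcongr

lemma maj_nonneg (q : ℤ → ℂ) {r s : ℝ} (hr : 0 ≤ r) (hs : 0 ≤ s) (top : ℤ) (k : ℕ) :
    0 ≤ maj q r s top k := by
  induction k with
  | zero => exact hs
  | succ k ih => unfold maj; positivity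

lemma conv_sq {x a y r : ℝ} (hr : 0 < r) (hr1 : r < 1) (hx : 0 ≤ x) (h : x ≤ a + r * y) :
    x ^ 2 ≤ a ^ 2 / (1 - r) + r * y ^ 2 := by
  have h1 : 0 < 1 - r := by linarith
  have h2 : x ^ 2 ≤ (a + r * y) ^ 2 := pow_le_pow_left₀ hx h 2
  refine h2.trans ?_
  rw [← sub_le_iff_le_add, le_div_iff₀ h1]
  nlinarith [mul_nonneg hr.le (sq_nonneg (a - (1 - r) * y))]

lemma maj_sum (q : ℤ → ℂ) {r s A : ℝ} (hr : 0 < r) (hr1 : r < 1) (hs : 0 ≤ s) (top : ℤ) (K : ℕ)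
    (hA : ∑ i ∈ Finset.range K, ‖q (top - 1 - i)‖ ^ 2 ≤ A) :
    ∑ i ∈ Finset.range K, maj q r s top (i + 1) ^ 2 ≤ A / (1 - r) ^ 2 + r / (1 - r) * s ^ 2 := by
  have h1 : 0 < 1 - r := by linarith
  set X := ∑ i ∈ Finset.range K, maj q r s top (i + 1) ^ 2 with hX
  have h2 : X ≤ ∑ i ∈ Finset.range K, (‖q (top - 1 - i)‖ ^ 2 / (1 - r) + r * maj q r s top i ^ 2) :=
    Finset.sum_le_sum fun i _ => conv_sq hr hr1 (maj_nonneg q hr.le hs top _) le_rfl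
  have h3 : ∑ i ∈ Finset.range K, maj q r s top i ^ 2 ≤ s ^ 2 + X := by
    have := Finset.sum_range_succ' (fun i => maj q r s top i ^ 2) K
    rw [Finset.sum_range_succ] at this
    have e : maj q r s top 0 = s := rfl
    rw [e] at this
    linarith [sq_nonneg (maj q r s top K)]
  rw [Finset.sum_add_distrib, ← Finset.sum_div, ← Finset.mul_sum] at h2
  have h4 : (∑ i ∈ Finset.range K, ‖q (top - 1 - i)‖ ^ 2) / (1 - r) ≤ A / (1 - r) := by gcongr
  have h5 : X * (1 - r) ≤ A / (1 - r) + r * s ^ 2 := by nlinarith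
  have h6 : A / (1 - r) ^ 2 + r / (1 - r) * s ^ 2 = (A / (1 - r) + r * s ^ 2) / (1 - r) := by
    field_simp
  rw [h6, le_div_iff₀ h1]
  exact h5

/-- exponent -/
def exq (p q : ℤ → ℂ) (r s κ : ℝ) (top : ℤ) (i : ℕ) : ℝ :=
  κ * (‖p (top - 1 - i)‖ * maj p r s top (i + 1) + ‖q (top - 1 - i)‖ * maj q r s top (i + 1))
    + (maj p r s top (i + 1) * maj q r s top (i + 1) + 2 * ‖p (top - 1 - i)‖ * maj q r s top (i + 1)
      + ‖p (top - 1 - i)‖ * ‖q (top - 1 - i)‖)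

lemma exq_sum (p q : ℤ → ℂ) {r s κ A : ℝ} (hr : 0 < r) (hr1 : r < 1) (hs : 0 ≤ s) (hκ : 0 ≤ κ)
    (top : ℤ) (K : ℕ)
    (hA : ∑ i ∈ Finset.range K, ‖p (top - 1 - i)‖ ^ 2 ≤ A)
    (hB : ∑ i ∈ Finset.range K, ‖q (top - 1 - i)‖ ^ 2 ≤ A) :
    ∑ i ∈ Finset.range K, exq p q r s κ top i
      ≤ (κ + 2) * (A + (A / (1 - r) ^ 2 + r / (1 - r) * s ^ 2)) := by
  have hx := maj_sum p hr hr1 hs top K hA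
  have hy := maj_sum q hr hr1 hs top K hB
  set Q := A / (1 - r) ^ 2 + r / (1 - r) * s ^ 2
  have h1 : ∑ i ∈ Finset.range K, exq p q r s κ top i ≤ ∑ i ∈ Finset.range K,
      ((κ / 2 + 3 / 2) * ‖p (top - 1 - i)‖ ^ 2 + (κ / 2 + 1 / 2) * ‖q (top - 1 - i)‖ ^ 2
        + (κ / 2 + 1 / 2) * maj p r s top (i + 1) ^ 2
        + (κ / 2 + 3 / 2) * maj q r s top (i + 1) ^ 2) := by
    refine Finset.sum_le_sum fun i _ => ?_
    unfold exq
    generalize ‖p (top - 1 - i)‖ = a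
    generalize ‖q (top - 1 - i)‖ = b
    generalize maj p r s top (i + 1) = x
    generalize maj q r s top (i + 1) = y
    nlinarith [mul_nonneg hκ (sq_nonneg (a - x)), mul_nonneg hκ (sq_nonneg (b - y)),
      sq_nonneg (x - y), sq_nonneg (a - y), sq_nonneg (a - b)]
  refine h1.trans ?_
  rw [Finset.sum_add_distrib, Finset.sum_add_distrib, Finset.sum_add_distrib, ← Finset.mul_sum,
    ← Finset.mul_sum, ← Finset.mul_sum, ← Finset.mul_sum]
  have a1 := mul_le_mul_of_nonneg_left hA (show 0 ≤ κ / 2 + 3 / 2 by positivity)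
  have a2 := mul_le_mul_of_nonneg_left hB (show 0 ≤ κ / 2 + 1 / 2 by positivity)
  have a3 := mul_le_mul_of_nonneg_left hx (show 0 ≤ κ / 2 + 1 / 2 by positivity)
  have a4 := mul_le_mul_of_nonneg_left hy (show 0 ≤ κ / 2 + 3 / 2 by positivity)
  linarith

lemma exq_nonneg (p q : ℤ → ℂ) {r s κ : ℝ} (hr : 0 ≤ r) (hs : 0 ≤ s) (hκ : 0 ≤ κ)
    (top : ℤ) (i : ℕ) : 0 ≤ exq p q r s κ top i := by
  have h1 := maj_nonneg p hr hs top (i + 1)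
  have h2 := maj_nonneg q hr hs top (i + 1)
  unfold exq
  positivity

/-- stability of the Schur algorithm -/
lemma stability (p q : ℤ → ℂ) (hp : ∀ n, ‖p n‖ < 1) (hq : ∀ n, ‖q n‖ < 1) {c d : ℂ → ℂ}
    {r s κ A D : ℝ} (hr : 0 < r) (hr1 : r < 1) (hs : 0 ≤ s) (hκ : 0 < κ) 
    (hc : DifferentiableOn ℂ c (ball 0 1)) (hc1 : ∀ z ∈ ball (0 : ℂ) 1, ‖c z‖ ≤ 1)
    (hd : DifferentiableOn ℂ d (ball 0 1)) (hd1 : ∀ z ∈ ball (0 : ℂ) 1, ‖d z‖ ≤ 1)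
    (hcs : ∀ z, ‖z‖ = r → ‖c z‖ ≤ s) (hds : ∀ z, ‖z‖ = r → ‖d z‖ ≤ s)
    (hκp : ∀ n, 1 / κ ≤ 1 - ‖p n‖) (hκq : ∀ n, 1 / κ ≤ 1 - ‖q n‖)
    (top : ℤ) (k m : ℕ)
    (hA : ∑ i ∈ Finset.range (k + 1 + m), ‖p (top - 1 - i)‖ ^ 2 ≤ A)
    (hB : ∑ i ∈ Finset.range (k + 1 + m), ‖q (top - 1 - i)‖ ^ 2 ≤ A)
    (hD : ∀ z, ‖z‖ = r → ‖fch p z (c z) top (k + 1 + m) - fch q z (d z) top (k + 1 + m)‖ ≤ D) :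
    ‖p (top - 1 - k) - q (top - 1 - k)‖ ≤ (r⁻¹) ^ m *
      Real.exp ((κ + 2) * (A + (A / (1 - r) ^ 2 + r / (1 - r) * s ^ 2))) * D := by
  have hbr : ∀ z ∈ ball (0 : ℂ) 1, ‖z‖ ≤ 1 := fun z hz => (mem_ball_zero_iff.1 hz).le
  have hrb : ∀ z : ℂ, ‖z‖ = r → z ∈ ball (0 : ℂ) 1 := fun z hz => by
    rw [mem_ball_zero_iff, hz]; exact hr1
  have step : ∀ i : ℕ, N2 r (fun z => fch p z (c z) top i - fch q z (d z) top i)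
      ≤ ENNReal.ofReal (r⁻¹ * Real.exp (exq p q r s κ top i)) *
        N2 r (fun z => fch p z (c z) top (i + 1) - fch q z (d z) top (i + 1)) := by
    intro i
    have := schur_step (f := fun z => fch p z (c z) top (i + 1))
      (g := fun z => fch q z (d z) top (i + 1)) (f' := fun z => fch p z (c z) top i)
      (g' := fun z => fch q z (d z) top i) (κ := κ) (x := maj p r s top (i + 1))
      (y := maj q r s top (i + 1)) hr hr1
      (fch_diff p hp hc hc1 top _) (fch_diff q hq hd hd1 top _)
      (fun z hz => fch_norm_le p hp (hbr z hz) (hc1 z hz) top _)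
      (fun z hz => fch_norm_le q hq (hbr z hz) (hd1 z hz) top _)
      (fun z hz => by
        rw [fch_zero]
        exact stp_rel (hp _) (norm_mul_le_one (hbr z hz)
          (fch_norm_le p hp (hbr z hz) (hc1 z hz) top _)))
      (fun z hz => by
        rw [fch_zero]
        exact stp_rel (hq _) (norm_mul_le_one (hbr z hz)
          (fch_norm_le q hq (hbr z hz) (hd1 z hz) top _)))
      (fun z hz => fch_maj p hp hz hr1 (hc1 z (hrb z hz)) (hcs z hz) top _)
      (fun z hz => fch_maj q hq hz hr1 (hd1 z (hrb z hz)) (hds z hz) top _)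
      hκ (by rw [fch_zero]; exact hκp _) (by rw [fch_zero]; exact hκq _)
    simp only [fch_zero] at this
    exact this
  have steps : ∀ m : ℕ, N2 r (fun z => fch p z (c z) top (k + 1) - fch q z (d z) top (k + 1))
      ≤ ENNReal.ofReal ((r⁻¹) ^ m * Real.exp (∑ i ∈ Finset.range m, exq p q r s κ top (k + 1 + i))) *
        N2 r (fun z => fch p z (c z) top (k + 1 + m) - fch q z (d z) top (k + 1 + m)) := by
    intro m
    induction m with
    | zero => simp
    | succ m ih =>
      refine ih.trans ((mul_le_mul_right (step (k + 1 + m)) _).trans (le_of_eq ?_))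
      rw [← mul_assoc, ← ENNReal.ofReal_mul (by positivity), Finset.sum_range_succ, Real.exp_add,
        pow_succ]
      congr 2
      ring
  have hD0 : 0 ≤ D := (norm_nonneg _).trans (hD r (by simp [abs_of_pos hr]))
  have h1 := N2_zero_le (f := fun z => fch p z (c z) top (k + 1) - fch q z (d z) top (k + 1))
    ((fch_diff p hp hc hc1 top _).sub (fch_diff q hq hd hd1 top _)) hr hr1 (C := 2)
    (fun z hz => (norm_sub_le _ _).trans (by
      linarith [fch_norm_le p hp (hbr z hz) (hc1 z hz) top (k + 1),
        fch_norm_le q hq (hbr z hz) (hd1 z hz) top (k + 1)]))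
  rw [fch_zero, fch_zero] at h1
  have h2 := h1.trans ((steps m).trans (mul_le_mul_right (N2_le hr hD) _))
  rw [← ENNReal.ofReal_mul (by positivity), ← ofReal_norm, ENNReal.ofReal_le_ofReal_iff (by positivity)]
    at h2
  refine h2.trans ?_
  gcongr
  have h3 := exq_sum p q hr hr1 hs hκ.le top (k + 1 + m) hA hB
  refine le_trans ?_ h3
  rw [Finset.sum_range_add]
  have : 0 ≤ ∑ x ∈ Finset.range (k + 1), exq p q r s κ top x :=
    Finset.sum_nonneg fun i _ => exq_nonneg p q hr.le hs hκ.le top i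
  linarith

lemma szego_prod {F : ℕ → ℂ → ℂ} (hF : IsSchurChain F) {η : ℝ} (hη : η ≤ szego F) (N : ℕ) :
    η ≤ ∏ k ∈ Finset.range N, (1 - ‖F k 0‖ ^ 2) := by
  refine hη.trans (ciInf_le ⟨0, ?_⟩ N)
  rintro _ ⟨N, rfl⟩
  exact Finset.prod_nonneg fun k _ => (one_sub_sq_pos (hF k).2.2.1).le

lemma szego_sum {F : ℕ → ℂ → ℂ} (hF : IsSchurChain F) {η : ℝ} (hη0 : 0 < η) (hη : η ≤ szego F) (N : ℕ) :
    ∑ k ∈ Finset.range N, -Real.log (1 - ‖F k 0‖ ^ 2) ≤ Real.log (1 / η) := by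
  rw [Finset.sum_neg_distrib, ← Real.log_prod (fun k _ => (one_sub_sq_pos (hF k).2.2.1).ne'), one_div,
    Real.log_inv]
  exact neg_le_neg (Real.log_le_log hη0 (szego_prod hF hη N))

lemma schur_stp {F : ℕ → ℂ → ℂ} (hF : IsSchurChain F) (n : ℕ) {z : ℂ} (hz : z ∈ ball (0 : ℂ) 1) :
    F n z = stp (F n 0) z (F (n + 1) z) :=
  stp_of_rel (hF n).2.2.1 (norm_mul_le_one (mem_ball_zero_iff.1 hz).le ((hF (n + 1)).2.1 z hz))
    ((hF n).2.2.2 z hz)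

lemma schur_sup {F : ℕ → ℂ → ℂ} (hF : IsSchurChain F) {η : ℝ} (hη0 : 0 < η) (hη : η ≤ szego F)
    {r : ℝ} (hr : 0 < r) (hr1 : r < 1) :
    ∃ s : ℕ → ℝ, (∀ n z, ‖z‖ = r → ‖F n z‖ ≤ s n) ∧ Tendsto s atTop (nhds 0) := by
  have hrb : ∀ z : ℂ, ‖z‖ = r → z ∈ ball (0 : ℂ) 1 := fun z hz => by
    rw [mem_ball_zero_iff, hz]; exact hr1
  haveI : Nonempty (sphere (0 : ℂ) r) := ⟨⟨(r : ℂ), by simp [abs_of_pos hr]⟩⟩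
  let σ : ℕ → ℝ := fun n => ⨆ z : sphere (0 : ℂ) r, ‖F n z‖
  have hle1 : ∀ n (z : sphere (0 : ℂ) r), ‖F n z‖ ≤ 1 := fun n z =>
    (hF n).2.1 _ (hrb _ (by simpa using z.2))
  have hbd : ∀ n, BddAbove (Set.range fun z : sphere (0 : ℂ) r => ‖F n z‖) := fun n =>
    ⟨1, by rintro _ ⟨z, rfl⟩; exact hle1 n z⟩
  have hσ : ∀ n z, ‖z‖ = r → ‖F n z‖ ≤ σ n := fun n z hz =>
    le_ciSup (hbd n) ⟨z, by simpa using hz⟩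
  have hσ1 : ∀ n, σ n ≤ 1 := fun n => ciSup_le (hle1 n)
  have hσ0 : ∀ n, 0 ≤ σ n := fun n => (norm_nonneg _).trans (hσ n r (by simp [abs_of_pos hr]))
  have hrec : ∀ n, σ n ≤ ‖F n 0‖ + r * σ (n + 1) := by
    intro n
    refine ciSup_le fun z => ?_
    have hz : ‖(z : ℂ)‖ = r := by simpa using z.2
    rw [schur_stp hF n (hrb _ hz)]
    refine (stp_norm_le_add (hF n).2.2.1 (norm_mul_le_one (hz.le.trans hr1.le) (hle1 _ z))).trans ?_
    rw [norm_mul, hz]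
    have := hσ (n + 1) z hz
    gcongr
  refine ⟨σ, hσ, ?_⟩
  have h1r : 0 < 1 - r := by linarith
  set A := Real.log (1 / η)
  have hsum : ∀ K, ∑ n ∈ Finset.range K, σ n ^ 2 ≤ (A / (1 - r) + r) / (1 - r) := by
    intro K
    have h1 : ∑ n ∈ Finset.range K, σ n ^ 2 ≤
        ∑ n ∈ Finset.range K, (‖F n 0‖ ^ 2 / (1 - r) + r * σ (n + 1) ^ 2) :=
      Finset.sum_le_sum fun n _ => conv_sq hr hr1 (hσ0 n) (hrec n)
    rw [Finset.sum_add_distrib, ← Finset.sum_div, ← Finset.mul_sum] at h1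
    have h2 : ∑ n ∈ Finset.range K, ‖F n 0‖ ^ 2 ≤ A := by
      refine le_trans (Finset.sum_le_sum fun n _ => ?_) (szego_sum hF hη0 hη K)
      have := Real.log_le_sub_one_of_pos (one_sub_sq_pos (hF n).2.2.1)
      linarith
    have h3 : ∑ n ∈ Finset.range K, σ (n + 1) ^ 2 ≤ ∑ n ∈ Finset.range K, σ n ^ 2 + 1 := by
      have := Finset.sum_range_succ' (fun n => σ n ^ 2) K
      rw [Finset.sum_range_succ] at this
      have h4 : σ K ^ 2 ≤ 1 := pow_le_one₀ (hσ0 K) (hσ1 K)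
      linarith [sq_nonneg (σ 0)]
    have h4 : (∑ n ∈ Finset.range K, ‖F n 0‖ ^ 2) / (1 - r) ≤ A / (1 - r) := by gcongr
    rw [le_div_iff₀ h1r]
    nlinarith
  have hsm : Summable fun n => σ n ^ 2 := summable_of_sum_range_le (fun n => sq_nonneg _) hsum
  have ht := hsm.tendsto_atTop_zero
  have := ht.sqrt
  simpa [Real.sqrt_sq (hσ0 _)] using this

lemma energy_init {F : ℕ → ℂ → ℂ} (hF : IsSchurChain F) {η : ℝ} (hη0 : 0 < η) (hη : η ≤ szego F)
    (q : ℝ → ℤ → ℂ) (h0 : ∀ n : ℤ, q 0 n = if 0 ≤ n then F n.toNat 0 else 0) (L : ℕ) :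
    ∑ k ∈ Finset.range (2 * L + 1), ell q ((k : ℤ) - L) 0 ≤ Real.log (1 / η) := by
  rw [show 2 * L + 1 = L + (L + 1) by ring, Finset.sum_range_add]
  have h1 : ∑ k ∈ Finset.range L, ell q ((k : ℤ) - L) 0 = 0 := by
    refine Finset.sum_eq_zero fun k hk => ?_
    have := Finset.mem_range.1 hk
    rw [ell, h0, if_neg (by omega)]
    simp
  rw [h1, zero_add]
  refine le_trans (le_of_eq ?_) (szego_sum hF hη0 hη (L + 1))
  refine Finset.sum_congr rfl fun k _ => ?_
  have e : (((L + k : ℕ) : ℤ) - L) = k := by push_cast; ring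
  rw [e, ell, h0, if_pos (by omega)]
  simp

lemma fch_init {F : ℕ → ℂ → ℂ} (hF : IsSchurChain F) (q : ℤ → ℂ)
    (h0 : ∀ n : ℤ, q n = if 0 ≤ n then F n.toNat 0 else 0) {z : ℂ} (hz : z ∈ ball (0 : ℂ) 1)
    (N M : ℕ) : fch q z (F N z) N (N + M) = z ^ M * F 0 z := by
  have h1 : ∀ k ≤ N, fch q z (F N z) N k = F (N - k) z := by
    intro k
    induction k with
    | zero => intro _; rfl
    | succ k ih =>
      intro hk
      rw [fch, ih (by omega), h0, if_pos (by omega), schur_stp hF (N - (k + 1)) hz]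
      congr 2
      · congr 1; omega
      · congr 1; omega
  induction M with
  | zero => rw [add_zero, h1 N le_rfl]; simp
  | succ M ih =>
    rw [← add_assoc, fch, ih, h0, if_neg (by push_cast; omega), stp]
    simp
    ring

lemma sum_window {q : ℝ → ℤ → ℂ} (hb : ∀ (s : ℝ) (m : ℤ), ‖q s m‖ < 1) {t A : ℝ}
    (h : ∀ S : Finset ℤ, ∑ n ∈ S, ell q n t ≤ A) (top : ℤ) (K : ℕ) :
    ∑ i ∈ Finset.range K, ‖q t (top - 1 - i)‖ ^ 2 ≤ A := by
  have := h ((Finset.range K).image fun i : ℕ => top - 1 - (i : ℤ))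
  rw [Finset.sum_image (by intro a _ b _ hab; simpa using hab)] at this
  exact (Finset.sum_le_sum fun i _ => ell_nonneg' q _ t (hb t _)).trans this

lemma kappa_le {q : ℝ → ℤ → ℂ} (hb : ∀ (s : ℝ) (m : ℤ), ‖q s m‖ < 1) {t η : ℝ} (hη0 : 0 < η)
    (h : ∀ S : Finset ℤ, ∑ n ∈ S, ell q n t ≤ Real.log (1 / η)) (n : ℤ) :
    1 - Real.sqrt (1 - η) ≤ 1 - ‖q t n‖ := by
  have h1 := h {n}
  rw [Finset.sum_singleton, ell, one_div, Real.log_inv, neg_le_neg_iff,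
    Real.log_le_log_iff hη0 (one_sub_sq_pos (hb t n))] at h1
  have := Real.le_sqrt_of_sq_le (show ‖q t n‖ ^ 2 ≤ 1 - η by linarith)
  linarith


theorem stmt10 (η : ℝ) (hη0 : 0 < η) (hη1 : η ≤ 1)
    (F G : ℕ → ℂ → ℂ) (hF : IsSchurChain F) (hG : IsSchurChain G)
    (hηF : η ≤ szego F) (hηG : η ≤ szego G)
    (q0F q0G : ℤ → ℂ)
    (hq0F : ∀ n : ℤ, q0F n = if 0 ≤ n then F n.toNat 0 else 0)
    (hq0G : ∀ n : ℤ, q0G n = if 0 ≤ n then G n.toNat 0 else 0)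
    (qF qG : ℝ → ℤ → ℂ)
    (hqFi : ∀ n : ℤ, qF 0 n = q0F n) (hqGi : ∀ n : ℤ, qG 0 n = q0G n)
    (hqF : ∀ (s : ℝ) (n : ℤ), HasDerivAt (fun u => qF u n) (ALDeriv qF s n) s)
    (hqG : ∀ (s : ℝ) (n : ℤ), HasDerivAt (fun u => qG u n) (ALDeriv qG s n) s)
    (hqFb : ∀ (s : ℝ) (m : ℤ), ‖qF s m‖ < 1)
    (hqGb : ∀ (s : ℝ) (m : ℤ), ‖qG s m‖ < 1) :
    ∀ (t : ℝ), 0 < t → ∀ (r : ℝ), 0 < r → r < 1 → ∀ (j : ℤ),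
      ‖qF t j - qG t j‖ ≤
        r ^ (-j) * Real.exp (t / r) * Cconst η r *
          ⨆ z ∈ Metric.sphere (0 : ℂ) r, ‖F 0 z - G 0 z‖ := by
  intro t ht r hr hr1 j
  have hrb : ∀ z : ℂ, ‖z‖ = r → z ∈ ball (0 : ℂ) 1 := fun z hz => by
    rw [mem_ball_zero_iff, hz]; exact hr1
  have hF0 : ∀ n : ℤ, qF 0 n = if 0 ≤ n then F n.toNat 0 else 0 := fun n => by rw [hqFi, hq0F]
  have hG0 : ∀ n : ℤ, qG 0 n = if 0 ≤ n then G n.toNat 0 else 0 := fun n => by rw [hqGi, hq0G]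
  set D := ⨆ z ∈ Metric.sphere (0 : ℂ) r, ‖F 0 z - G 0 z‖ with hD
  have hDle : ∀ z, ‖z‖ = r → ‖F 0 z - G 0 z‖ ≤ D := by
    intro z hz
    have hb2 : ∀ w : ℂ, ‖w‖ = r → ‖F 0 w - G 0 w‖ ≤ 2 := fun w hw =>
      (norm_sub_le _ _).trans (by
        linarith [(hF 0).2.1 w (hrb w hw), (hG 0).2.1 w (hrb w hw)])
    have hzs : z ∈ Metric.sphere (0 : ℂ) r := by simpa using hz
    have bdd : BddAbove (Set.range fun w : ℂ => ⨆ (_ : w ∈ Metric.sphere (0 : ℂ) r), ‖F 0 w - G 0 w‖) := by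
      refine ⟨2, ?_⟩
      rintro _ ⟨w, rfl⟩
      exact Real.iSup_le (fun hw => hb2 w (by simpa using hw)) (by norm_num)
    have := le_ciSup bdd z
    simp only [hzs, ciSup_unique] at this
    exact this
  set A := Real.log (1 / η) with hA
  have hA0 : 0 ≤ A := Real.log_nonneg (by rw [le_div_iff₀ hη0]; linarith)
  have cF := conservation qF hqF hqFb A (energy_init hF hη0 hηF qF hF0) t ht.le
  have cG := conservation qG hqG hqGb A (energy_init hG hη0 hηG qG hG0) t ht.le
  have hsq : Real.sqrt (1 - η) < 1 := by
    rw [Real.sqrt_lt' one_pos]; linarith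
  set κ := 1 / (1 - Real.sqrt (1 - η)) with hκ
  have hκ0 : 0 < κ := by rw [hκ]; apply one_div_pos.2; linarith
  have hκi : 1 / κ = 1 - Real.sqrt (1 - η) := by rw [hκ, one_div_one_div]
  obtain ⟨sF, hsF, hsF0⟩ := schur_sup hF hη0 hηF hr hr1
  obtain ⟨sG, hsG, hsG0⟩ := schur_sup hG hη0 hηG hr hr1
  have sFn : ∀ n, 0 ≤ sF n := fun n => (norm_nonneg _).trans (hsF n r (by simp [abs_of_pos hr]))
  have sGn : ∀ n, 0 ≤ sG n := fun n => (norm_nonneg _).trans (hsG n r (by simp [abs_of_pos hr]))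
  set s : ℕ → ℝ := fun n => sF n + sG n with hs
  have hs0 : Tendsto s atTop (nhds 0) := by simpa using hsF0.add hsG0
  set B := (4 + 2 * r + 2 / r) / (1 - r ^ 2)
  -- main finite inequality
  have fin : ∀ (M N : ℕ), 0 ≤ (M : ℤ) + j → j < N →
      ‖qF t j - qG t j‖ ≤ (r⁻¹) ^ ((M : ℤ) + j).toNat *
        Real.exp ((κ + 2) * (A + (A / (1 - r) ^ 2 + r / (1 - r) * s N ^ 2))) *
        (Real.exp (t / r) * (r ^ M * D + t * (Real.exp (t * (r + 1 / r)) *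
          (2 * ((2 * t) ^ M / (M.factorial : ℝ) * (5 + 1 / r) + r ^ (N + M) * B))))) := by
    intro M N hM hN
    obtain ⟨k, hk⟩ : ∃ k : ℕ, (N : ℤ) - 1 - k = j := ⟨((N : ℤ) - 1 - j).toNat, by omega⟩
    set m := ((M : ℤ) + j).toNat with hm
    have hkm : k + 1 + m = N + M := by omega
    have st := stability (qF t) (qG t) (hqFb t) (hqGb t) (c := F N) (d := G N) (κ := κ) (s := s N)
      (A := A) (D := (Real.exp (t / r) * (r ^ M * D + t * (Real.exp (t * (r + 1 / r)) *
          (2 * ((2 * t) ^ M / (M.factorial : ℝ) * (5 + 1 / r) + r ^ (N + M) * B)))))) hr hr1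
      (add_nonneg (sFn N) (sGn N)) hκ0
      (hF N).1 (hF N).2.1 (hG N).1 (hG N).2.1
      (fun z hz => (hsF N z hz).trans (by simp [hs, sGn N]))
      (fun z hz => (hsG N z hz).trans (by simp [hs, sFn N]))
      (fun n => by rw [hκi]; exact kappa_le hqFb hη0 cF n)
      (fun n => by rw [hκi]; exact kappa_le hqGb hη0 cG n)
      (N : ℤ) k m (sum_window hqFb cF _ _) (sum_window hqGb cG _ _) ?_
    · rw [hk] at st; exact st
    · intro z hz
      rw [hkm]
      have e : (N : ℤ) - ((N + M : ℕ) : ℤ) = -(M : ℤ) := by push_cast; ring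
      have dec : ∀ (q : ℝ → ℤ → ℂ)
          (_ : ∀ (s : ℝ) (n : ℤ), HasDerivAt (fun u => q u n) (ALDeriv q s n) s)
          (_ : ∀ (s : ℝ) (m : ℤ), ‖q s m‖ < 1) (_ : ∀ n : ℤ, n < 0 → q 0 n = 0),
          ∀ u, 0 ≤ u → u ≤ t → ∀ n, n ≤ (N : ℤ) - ((N + M : ℕ) : ℤ) →
            ‖q u n‖ ≤ (2 * t) ^ M / (M.factorial : ℝ) := by
        intro q h1 h2 h3 u hu hut n hn
        refine (left_decay q h1 h2 h3 M n (by rwa [e] at hn) u hu).trans ?_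
        gcongr
      have ev := delta_evol qF qG hqF hqG hqFb hqGb ht.le hr hr1 hz
        ((hF N).2.1 z (hrb z hz)) ((hG N).2.1 z (hrb z hz)) (N : ℤ) (N + M)
        (dec qF hqF hqFb fun n hn => by rw [hF0, if_neg (by omega)])
        (dec qG hqG hqGb fun n hn => by rw [hG0, if_neg (by omega)])
      refine ev.trans ?_
      rw [fch_init hF (qF 0) hF0 (hrb z hz), fch_init hG (qG 0) hG0 (hrb z hz), ← mul_sub, norm_mul,
        norm_pow, hz]
      have := hDle z hz
      gcongr
  -- let N tend to infinity
  have hr0 : Tendsto (fun n : ℕ => r ^ n) atTop (nhds 0) :=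
    tendsto_pow_atTop_nhds_zero_of_lt_one hr.le hr1
  have fin2 : ∀ (M : ℕ), 0 ≤ (M : ℤ) + j →
      ‖qF t j - qG t j‖ ≤ (r⁻¹) ^ ((M : ℤ) + j).toNat *
        Real.exp ((κ + 2) * (A + (A / (1 - r) ^ 2 + r / (1 - r) * 0 ^ 2))) *
        (Real.exp (t / r) * (r ^ M * D + t * (Real.exp (t * (r + 1 / r)) *
          (2 * ((2 * t) ^ M / (M.factorial : ℝ) * (5 + 1 / r) + 0 * B))))) := by
    intro M hM
    refine ge_of_tendsto (f := fun N : ℕ => (r⁻¹) ^ ((M : ℤ) + j).toNat *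
        Real.exp ((κ + 2) * (A + (A / (1 - r) ^ 2 + r / (1 - r) * s N ^ 2))) *
        (Real.exp (t / r) * (r ^ M * D + t * (Real.exp (t * (r + 1 / r)) *
          (2 * ((2 * t) ^ M / (M.factorial : ℝ) * (5 + 1 / r) + r ^ (N + M) * B)))))) (x := atTop) ?_ ?_
    · have l1 : Tendsto (fun N : ℕ => r ^ (N + M)) atTop (nhds 0) :=
        hr0.comp (tendsto_add_atTop_nat M)
      refine Tendsto.mul (Tendsto.const_mul _ ?_) (Tendsto.const_mul _ (Tendsto.const_add _
        (Tendsto.const_mul _ (Tendsto.const_mul _ (Tendsto.const_mul _ (Tendsto.const_add _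
          (l1.mul_const B)))))))
      exact (Real.continuous_exp.tendsto _).comp (Tendsto.const_mul _ (Tendsto.const_add _
        (Tendsto.const_add _ (Tendsto.const_mul _ (hs0.pow 2)))))
    · filter_upwards [eventually_gt_atTop j.toNat] with N hN
      exact fin M N hM (by omega)
  -- let M tend to infinity
  set X := Real.exp ((κ + 2) * (A + A / (1 - r) ^ 2)) with hX
  set c1 := t * (Real.exp (t * (r + 1 / r)) * (2 * (5 + 1 / r))) with hc1
  have fin3 : ‖qF t j - qG t j‖ ≤ r ^ (-j) * X * (Real.exp (t / r) * (D + c1 * 0)) := by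
    have lim := (FloorSemiring.tendsto_pow_div_factorial_atTop (2 * t / r)).const_mul c1
    have lim2 := ((lim.const_add D).const_mul (Real.exp (t / r))).const_mul (r ^ (-j) * X)
    refine ge_of_tendsto lim2 ?_
    filter_upwards [eventually_ge_atTop (-j).toNat] with M hM
    have hMj : 0 ≤ (M : ℤ) + j := by omega
    refine (fin2 M hMj).trans (le_of_eq ?_)
    have hz : (r⁻¹) ^ ((M : ℤ) + j).toNat = r ^ (-j) * (r ^ M)⁻¹ := by
      rw [← zpow_natCast (r⁻¹), Int.toNat_of_nonneg hMj, inv_zpow', neg_add,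
        zpow_add₀ hr.ne', zpow_neg, zpow_natCast, mul_comm]
    rw [hz, hX, hc1, div_pow]
    have hrM : r ^ M ≠ 0 := by positivity
    have e0 : (κ + 2) * (A + (A / (1 - r) ^ 2 + r / (1 - r) * 0 ^ 2))
        = (κ + 2) * (A + A / (1 - r) ^ 2) := by ring
    rw [e0]
    generalize Real.exp ((κ + 2) * (A + A / (1 - r) ^ 2)) = Y
    generalize r ^ (-j) = Z
    generalize Real.exp (t * (r + 1 / r)) = W
    generalize Real.exp (t / r) = V
    have hfac : (M.factorial : ℝ) ≠ 0 := by positivity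
    field_simp
    ring
  have hD0 : 0 ≤ D := (norm_nonneg _).trans (hDle r (by simp [abs_of_pos hr]))
  have hXC : X ≤ Cconst η r := by
    rw [hX, Cconst, Real.exp_le_exp, ← hA, ← hκ]
    have h1 : A / (1 - r) ^ 2 = A * (1 / (1 - r) ^ 2) := by ring
    have h2 : 4 / (1 - r) ^ 2 = 4 * (1 / (1 - r) ^ 2) := by ring
    rw [h1, h2]
    have h3 : 0 ≤ 1 / (1 - r) ^ 2 := by positivity
    generalize 1 / (1 - r) ^ 2 = y at h3
    have h4 : 0 ≤ A * (2 + κ) * (3 * y) := by positivity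
    nlinarith
  refine fin3.trans ?_
  rw [mul_zero, add_zero]
  calc r ^ (-j) * X * (Real.exp (t / r) * D) = r ^ (-j) * Real.exp (t / r) * X * D := by ring
    _ ≤ _ := by gcongr
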